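/- arXiv:0711.2666 — 2 statements merged into one kernel-verified Lean document; each statement's English description precedes it below -/
import Mathlib

section
/- The function D ↦ Λ*(P,Q,D) is convex, lower semicontinuous, nonnegative, nonincreasing and right-continuous; it is identically +∞ on (−∞, D_min) and identically 0 on [D_ave, ∞), where D_min := inf{D : Λ*(P,Q,D) < ∞} and D_ave := E ρ(X,Y). If D ≤ D_ave, then Λ*(P,Q,D) = sup_{λ∈ℝ}[λD − Λ(P,Q,λ)]. If D_min < ∞, then D_min = E ρ_Q(X) and Λ*(P,Q,·) is finite and continuously differentiable on (D_min, ∞). -/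
open MeasureTheory Filter Set Topology Classical
open scoped ENNReal NNReal

noncomputable section

/-- `-log t` as a value in `ℝ≥0∞` (equal to `∞` when `t = 0`); intended for `t ≤ 1`. -/
def negLog (t : ℝ≥0∞) : ℝ≥0∞ :=
  if t = 0 then ∞ else ENNReal.ofReal (-Real.log t.toReal)

/-- `log t` as a value in `ℝ≥0∞` (equal to `∞` when `t = ∞`); intended for `t ≥ 1`. -/
def posLog (t : ℝ≥0∞) : ℝ≥0∞ :=
  if t = ∞ then ∞ else ENNReal.ofReal (Real.log t.toReal)

/-- The extended-real-valued logarithm of an `ℝ≥0∞` number. -/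
def eLog (t : ℝ≥0∞) : EReal :=
  if t = 0 then ⊥ else if t = ∞ then ⊤ else ((Real.log t.toReal : ℝ) : EReal)

/-- Relative entropy `H(μ‖ν)` (in nats), valued in `ℝ≥0∞`: it equals
`∫ log (dμ/dν) dμ` when `μ ≪ ν` (and `+∞` when this integral is not defined,
which for probability measures can only mean `+∞`), and `+∞` when `¬ μ ≪ ν`. -/
def relEnt {α : Type*} [MeasurableSpace α] (μ ν : Measure α) : ℝ≥0∞ :=
  if μ ≪ ν ∧ Integrable (llr μ ν) μ then ENNReal.ofReal (∫ x, llr μ ν x ∂μ) else ∞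

/-- The set `W(P,D)` of couplings: probability measures on `S × T` with first
marginal `P` and expected distortion at most `D`. -/
def distSet {S T : Type*} [MeasurableSpace S] [MeasurableSpace T]
    (ρ : S × T → ℝ) (P : Measure S) (D : ℝ) : Set (Measure (S × T)) :=
  {W | IsProbabilityMeasure W ∧ W.map Prod.fst = P ∧
    ((∫⁻ z, ENNReal.ofReal (ρ z) ∂W : ℝ≥0∞) : EReal) ≤ ((D : ℝ) : EReal)}

/-- The rate function `R(P,Q,D) = inf_{W ∈ W(P,D)} H(W‖P×Q)` (equal to `+∞`
when `W(P,D)` is empty). -/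
def Rrate {S T : Type*} [MeasurableSpace S] [MeasurableSpace T]
    (ρ : S × T → ℝ) (P : Measure S) (Q : Measure T) (D : ℝ) : ℝ≥0∞ :=
  ⨅ W ∈ distSet ρ P D, relEnt W (P.prod Q)

/-- `Λ(P,Q,λ) = E_X[log E_Y e^{λρ(X,Y)}]`, valued in `EReal`.
For `λ ≥ 0` the integrand lies in `[0,∞]`; for `λ < 0` it lies in `[-∞,0]`. -/
def Lam {S T : Type*} [MeasurableSpace S] [MeasurableSpace T]
    (ρ : S × T → ℝ) (P : Measure S) (Q : Measure T) (l : ℝ) : EReal :=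
  if 0 ≤ l then
    ((∫⁻ x, posLog (∫⁻ y, ENNReal.ofReal (Real.exp (l * ρ (x, y))) ∂Q) ∂P : ℝ≥0∞) : EReal)
  else
    -(((∫⁻ x, negLog (∫⁻ y, ENNReal.ofReal (Real.exp (l * ρ (x, y))) ∂Q) ∂P : ℝ≥0∞) : EReal))

/-- The Fenchel–Legendre transform `Λ*(P,Q,D) = sup_{λ ≤ 0} [λD - Λ(P,Q,λ)]`. -/
def LamStar {S T : Type*} [MeasurableSpace S] [MeasurableSpace T]
    (ρ : S × T → ℝ) (P : Measure S) (Q : Measure T) (D : ℝ) : EReal :=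
  ⨆ l ∈ Iic (0 : ℝ), (((l * D : ℝ) : EReal) - Lam ρ P Q l)

/-- `ρ_Q(x) := essinf_{Y ∼ Q} ρ(x,Y)`. -/
def rhoQ {S T : Type*} [MeasurableSpace T]
    (ρ : S × T → ℝ) (Q : Measure T) (x : S) : ℝ :=
  essInf (fun y => ρ (x, y)) Q

/-- `D_min(P,Q) := inf {D : Λ*(P,Q,D) < ∞}`. -/
def DminPQ {S T : Type*} [MeasurableSpace S] [MeasurableSpace T]
    (ρ : S × T → ℝ) (P : Measure S) (Q : Measure T) : ℝ :=
  sInf {D : ℝ | LamStar ρ P Q D ≠ ⊤}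

/-- `D_ave(P,Q) := E ρ(X,Y)` for independent `X ∼ P`, `Y ∼ Q`, valued in `ℝ≥0∞`. -/
def DavePQ {S T : Type*} [MeasurableSpace S] [MeasurableSpace T]
    (ρ : S × T → ℝ) (P : Measure S) (Q : Measure T) : ℝ≥0∞ :=
  ∫⁻ z, ENNReal.ofReal (ρ z) ∂(P.prod Q)

/-- The candidate derivative `Λ'(λ)` of `Λ(P,Q,·)`. -/
def LamD {S T : Type*} [MeasurableSpace S] [MeasurableSpace T]
    (ρ : S × T → ℝ) (P : Measure S) (Q : Measure T) (l : ℝ) : ℝ :=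
  ∫ x, (∫ y, ρ (x, y) * Real.exp (l * ρ (x, y)) ∂Q) /
    (∫ y, Real.exp (l * ρ (x, y)) ∂Q) ∂P

/-- The left shift on sequences. -/
def shiftSeq {α : Type*} (x : ℕ → α) (n : ℕ) : α := x (n + 1)

/-- The single-letter distortion measure `ρ_n` on `n`-strings. -/
def rhoFin {S T : Type*} (ρ : S × T → ℝ) (n : ℕ) (x : Fin n → S) (y : Fin n → T) : ℝ :=
  (n : ℝ)⁻¹ * ∑ k, ρ (x k, y k)

/-- `L_n(x_1^n, Q^n, D) = -(1/n) log Q^n(B_n(x_1^n,D))`, valued in `ℝ≥0∞`,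
for a memoryless (product) codebook distribution `Q^n`. -/
def LnIID {S T : Type*} [MeasurableSpace T]
    (ρ : S × T → ℝ) (Q : Measure T) (D : ℝ) (n : ℕ) (x : ℕ → S) : ℝ≥0∞ :=
  (n : ℝ≥0∞)⁻¹ *
    negLog ((Measure.pi fun _ : Fin n => Q) {y | rhoFin ρ n (fun k => x k) y ≤ D})

/-- The empirical distribution `P_{x_1^n} = (1/n) ∑_{k=1}^n δ_{x_k}`. -/
def empMeas {S : Type*} [MeasurableSpace S] (n : ℕ) (x : ℕ → S) : Measure S :=
  (n : ℝ≥0∞)⁻¹ • ∑ k ∈ Finset.range n, Measure.dirac (x k)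

/-- The `n`-dimensional marginal of a measure on sequences. -/
def margN {α : Type*} [MeasurableSpace α] (μ : Measure (ℕ → α)) (n : ℕ) :
    Measure (Fin n → α) :=
  μ.map fun x (k : Fin n) => x (k : ℕ)

/-- The strong mixing condition `C⁻¹ 𝒬(A) 𝒬(B) ≤ 𝒬(A ∩ B) ≤ C 𝒬(A) 𝒬(B)` for all
`A ∈ σ(Y_1^n)`, `B ∈ σ(Y_{n+1}^∞)` and all `n`. -/
def Mixing {T : Type*} [MeasurableSpace T] (𝒬 : Measure (ℕ → T)) (C : ℝ) : Prop :=
  ∀ (n : ℕ) (A B : Set (ℕ → T)),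
    MeasurableSet[MeasurableSpace.comap (fun y (k : Fin n) => y (k : ℕ)) inferInstance] A →
    MeasurableSet[MeasurableSpace.comap (fun y (k : ℕ) => y (k + n)) inferInstance] B →
    (ENNReal.ofReal C)⁻¹ * (𝒬 A * 𝒬 B) ≤ 𝒬 (A ∩ B) ∧
      𝒬 (A ∩ B) ≤ ENNReal.ofReal C * (𝒬 A * 𝒬 B)

/-- `L_n(x_1^n, Q_n, D) = -(1/n) log Q_n(B_n(x_1^n,D))` where `Q_n` is the
`n`-dimensional marginal of the codebook process law `𝒬`. -/
def LnMem {S T : Type*} [MeasurableSpace T]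
    (ρ : S × T → ℝ) (𝒬 : Measure (ℕ → T)) (D : ℝ) (n : ℕ) (x : ℕ → S) : ℝ≥0∞ :=
  (n : ℝ≥0∞)⁻¹ * negLog (margN 𝒬 n {y | rhoFin ρ n (fun k => x k) y ≤ D})

/-- The set `W_n(P_n,D)` of couplings on `S^n × T^n`. -/
def distSetN {S T : Type*} [MeasurableSpace S] [MeasurableSpace T]
    (ρ : S × T → ℝ) (n : ℕ) (Pn : Measure (Fin n → S)) (D : ℝ) :
    Set (Measure ((Fin n → S) × (Fin n → T))) :=
  {W | IsProbabilityMeasure W ∧ W.map Prod.fst = Pn ∧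
    ((∫⁻ z, ENNReal.ofReal (rhoFin ρ n z.1 z.2) ∂W : ℝ≥0∞) : EReal) ≤ ((D : ℝ) : EReal)}

/-- `R_n(P_n,Q_n,D) = (1/n) inf_{W_n ∈ W_n(P_n,D)} H(W_n‖P_n×Q_n)`. -/
def RnMem {S T : Type*} [MeasurableSpace S] [MeasurableSpace T]
    (ρ : S × T → ℝ) (n : ℕ) (Pn : Measure (Fin n → S)) (Qn : Measure (Fin n → T))
    (D : ℝ) : ℝ≥0∞ :=
  (n : ℝ≥0∞)⁻¹ * ⨅ W ∈ distSetN ρ n Pn D, relEnt W (Pn.prod Qn)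

/-- `Λ_n(P_n,Q_n,λ) = E_{X_1^n}[log E_{Y_1^n} e^{λ ρ_n(X_1^n,Y_1^n)}]`. -/
def LamN {S T : Type*} [MeasurableSpace S] [MeasurableSpace T]
    (ρ : S × T → ℝ) (n : ℕ) (Pn : Measure (Fin n → S)) (Qn : Measure (Fin n → T))
    (l : ℝ) : EReal :=
  Lam (fun z => rhoFin ρ n z.1 z.2) Pn Qn l

/-- `Λ_n*(P_n,Q_n,D) = (1/n) sup_{λ ≤ 0} [λD - Λ_n(P_n,Q_n,λ)]`. -/
def LamStarN {S T : Type*} [MeasurableSpace S] [MeasurableSpace T]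
    (ρ : S × T → ℝ) (n : ℕ) (Pn : Measure (Fin n → S)) (Qn : Measure (Fin n → T))
    (D : ℝ) : EReal :=
  (((n : ℝ)⁻¹ : ℝ) : EReal) *
    ⨆ l ∈ Iic (0 : ℝ), (((l * D : ℝ) : EReal) - LamN ρ n Pn Qn l)

/-- One-sided Fenchel–Legendre transform `D ↦ sup_{λ ≤ 0} [λD - Λ(λ)]` of a
function `Λ : ℝ → EReal`. -/
def FLT (L : ℝ → EReal) (D : ℝ) : EReal :=
  ⨆ l ∈ Iic (0 : ℝ), (((l * D : ℝ) : EReal) - L l)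

section OneVar

variable {T : Type*} [MeasurableSpace T]

lemma ov_int {X : T → ℝ} {Q : Measure T} [IsProbabilityMeasure Q] (hX : Measurable X)
    (h0 : ∀ y, 0 ≤ X y) {l : ℝ} (hl : l ≤ 0) : Integrable (fun y => Real.exp (l * X y)) Q := by
  refine Integrable.of_bound (C := 1) (by fun_prop) (ae_of_all _ fun y => ?_)
  rw [Real.norm_of_nonneg (Real.exp_pos _).le, Real.exp_le_one_iff]
  exact mul_nonpos_of_nonpos_of_nonneg hl (h0 y)

lemma ov_pos {X : T → ℝ} {Q : Measure T} [IsProbabilityMeasure Q] (hX : Measurable X)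
    (h0 : ∀ y, 0 ≤ X y) {l : ℝ} (hl : l ≤ 0) : 0 < ProbabilityTheory.mgf X Q l :=
  ProbabilityTheory.mgf_pos (ov_int hX h0 hl)

lemma ov_cgf_mono {X : T → ℝ} {Q : Measure T} [IsProbabilityMeasure Q] (hX : Measurable X)
    (h0 : ∀ y, 0 ≤ X y) {l l' : ℝ} (hll : l ≤ l') (hl : l' ≤ 0) :
    ProbabilityTheory.cgf X Q l ≤ ProbabilityTheory.cgf X Q l' := by
  unfold ProbabilityTheory.cgf
  apply Real.log_le_log (ov_pos hX h0 (hll.trans hl))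
  unfold ProbabilityTheory.mgf
  apply integral_mono (ov_int hX h0 (hll.trans hl)) (ov_int hX h0 hl)
  intro y
  exact Real.exp_le_exp.2 (mul_le_mul_of_nonneg_right hll (h0 y))

lemma ov_cgf_nonpos {X : T → ℝ} {Q : Measure T} [IsProbabilityMeasure Q] (hX : Measurable X)
    (h0 : ∀ y, 0 ≤ X y) {l : ℝ} (hl : l ≤ 0) :
    ProbabilityTheory.cgf X Q l ≤ 0 := by
  have := ov_cgf_mono (Q := Q) hX h0 hl le_rfl
  simpa using this

lemma ov_lint {X : T → ℝ} {Q : Measure T} [IsProbabilityMeasure Q] (hX : Measurable X)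
    (h0 : ∀ y, 0 ≤ X y) {l : ℝ} (hl : l ≤ 0) :
    ∫⁻ y, ENNReal.ofReal (Real.exp (l * X y)) ∂Q = ENNReal.ofReal (ProbabilityTheory.mgf X Q l) := by
  unfold ProbabilityTheory.mgf
  rw [ofReal_integral_eq_lintegral_ofReal (ov_int hX h0 hl) (ae_of_all _ fun y => (Real.exp_pos _).le)]

lemma ov_negLog {X : T → ℝ} {Q : Measure T} [IsProbabilityMeasure Q] (hX : Measurable X)
    (h0 : ∀ y, 0 ≤ X y) {l : ℝ} (hl : l ≤ 0) :
    negLog (∫⁻ y, ENNReal.ofReal (Real.exp (l * X y)) ∂Q)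
      = ENNReal.ofReal (-ProbabilityTheory.cgf X Q l) := by
  have hp := ov_pos (Q := Q) hX h0 hl
  rw [ov_lint hX h0 hl, negLog, if_neg (by simpa using hp), ENNReal.toReal_ofReal hp.le]
  rfl

lemma ov_cgf_convex {X : T → ℝ} {Q : Measure T} [IsProbabilityMeasure Q] (hX : Measurable X)
    (h0 : ∀ y, 0 ≤ X y) {l l' a b : ℝ} (hl : l ≤ 0) (hl' : l' ≤ 0) (ha : 0 ≤ a) (hb : 0 ≤ b)
    (hab : a + b = 1) :
    ProbabilityTheory.cgf X Q (a * l + b * l')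
      ≤ a * ProbabilityTheory.cgf X Q l + b * ProbabilityTheory.cgf X Q l' := by
  have h1 := ENNReal.lintegral_mul_norm_pow_le (μ := Q)
    (f := fun y => ENNReal.ofReal (Real.exp (l * X y)))
    (g := fun y => ENNReal.ofReal (Real.exp (l' * X y))) (by fun_prop) (by fun_prop) ha hb hab
  have hp := ov_pos (Q := Q) hX h0 hl
  have hp' := ov_pos (Q := Q) hX h0 hl'
  have hs : a * l + b * l' ≤ 0 := by nlinarith
  have hps := ov_pos (Q := Q) hX h0 hs
  have e : ∀ y, ENNReal.ofReal (Real.exp (l * X y)) ^ a * ENNReal.ofReal (Real.exp (l' * X y)) ^ b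
      = ENNReal.ofReal (Real.exp ((a * l + b * l') * X y)) := by
    intro y
    rw [ENNReal.ofReal_rpow_of_pos (Real.exp_pos _), ENNReal.ofReal_rpow_of_pos (Real.exp_pos _),
      ← ENNReal.ofReal_mul (by positivity), ← Real.exp_mul, ← Real.exp_mul, ← Real.exp_add]
    congr 2; ring
  simp_rw [e] at h1
  rw [ov_lint hX h0 hl, ov_lint hX h0 hl', ov_lint hX h0 hs, ENNReal.ofReal_rpow_of_pos hp,
    ENNReal.ofReal_rpow_of_pos hp', ← ENNReal.ofReal_mul (by positivity),
    ENNReal.ofReal_le_ofReal_iff (by positivity)] at h1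
  unfold ProbabilityTheory.cgf
  rw [← Real.log_rpow hp, ← Real.log_rpow hp', ← Real.log_mul (by positivity) (by positivity)]
  exact Real.log_le_log hps h1

lemma ov_cgf_cont {X : T → ℝ} {Q : Measure T} [IsProbabilityMeasure Q] (hX : Measurable X)
    (h0 : ∀ y, 0 ≤ X y) : ContinuousOn (ProbabilityTheory.cgf X Q) (Iic 0) := by
  unfold ProbabilityTheory.cgf
  apply ContinuousOn.log
  · unfold ProbabilityTheory.mgf
    refine continuousOn_of_dominated (bound := fun _ => 1) ?_ ?_ (by fun_prop) ?_
    · intro l _; fun_prop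
    · intro l hl
      refine ae_of_all _ fun y => ?_
      rw [Real.norm_of_nonneg (Real.exp_pos _).le, Real.exp_le_one_iff]
      exact mul_nonpos_of_nonpos_of_nonneg hl (h0 y)
    · exact ae_of_all _ fun y => by fun_prop
  · intro l hl; exact (ov_pos hX h0 hl).ne'

lemma ov_jensen {X : T → ℝ} {Q : Measure T} [IsProbabilityMeasure Q] {l : ℝ}
    (hi : Integrable X Q) (he : Integrable (fun y => Real.exp (l * X y)) Q) :
    l * ∫ y, X y ∂Q ≤ ProbabilityTheory.cgf X Q l := by
  have hp : 0 < ProbabilityTheory.mgf X Q l := ProbabilityTheory.mgf_pos he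
  unfold ProbabilityTheory.cgf
  rw [Real.le_log_iff_exp_le hp]
  unfold ProbabilityTheory.mgf
  set c := ∫ y, X y ∂Q with hc
  have h1 : ∫ y, Real.exp (l * c) * (1 + l * (X y - c)) ∂Q ≤ ∫ y, Real.exp (l * X y) ∂Q := by
    apply integral_mono _ he
    · intro y
      have := Real.add_one_le_exp (l * (X y - c))
      have h2 : Real.exp (l * X y) = Real.exp (l * c) * Real.exp (l * (X y - c)) := by
        rw [← Real.exp_add]; congr 1; ring
      simp only
      rw [h2]
      exact mul_le_mul_of_nonneg_left (by linarith) (Real.exp_pos _).le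
    · fun_prop
  have h2 : ∫ y, Real.exp (l * c) * (1 + l * (X y - c)) ∂Q = Real.exp (l * c) := by
    rw [integral_const_mul, integral_add (by fun_prop) (by fun_prop), integral_const_mul,
      integral_sub hi (by fun_prop), ← hc]
    simp
  rwa [h2] at h1

lemma ov_jensen_neg {X : T → ℝ} {Q : Measure T} [IsProbabilityMeasure Q] (hX : Measurable X)
    (h0 : ∀ y, 0 ≤ X y) {l : ℝ} (hl : l ≤ 0) :
    ENNReal.ofReal (-ProbabilityTheory.cgf X Q l)
      ≤ ENNReal.ofReal (-l) * ∫⁻ y, ENNReal.ofReal (X y) ∂Q := by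
  rcases hl.eq_or_lt with rfl | hl'
  · simp
  by_cases hT : ∫⁻ y, ENNReal.ofReal (X y) ∂Q = ⊤
  · rw [hT, ENNReal.mul_top (by simpa using hl')]; exact le_top
  have hi : Integrable X Q := by
    refine (lintegral_ofReal_ne_top_iff_integrable (by fun_prop) (ae_of_all _ h0)).1 hT
  rw [← ofReal_integral_eq_lintegral_ofReal hi (ae_of_all _ h0), ← ENNReal.ofReal_mul (by linarith)]
  apply ENNReal.ofReal_le_ofReal
  have := ov_jensen hi (ov_int (Q := Q) hX h0 hl)
  linarith

lemma ov_jensen_pos {X : T → ℝ} {Q : Measure T} [IsProbabilityMeasure Q] (hX : Measurable X)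
    (h0 : ∀ y, 0 ≤ X y) {l : ℝ} (hl : 0 < l) :
    ENNReal.ofReal l * ∫⁻ y, ENNReal.ofReal (X y) ∂Q
      ≤ posLog (∫⁻ y, ENNReal.ofReal (Real.exp (l * X y)) ∂Q) := by
  unfold posLog
  split_ifs with hT
  · exact le_top
  have he : Integrable (fun y => Real.exp (l * X y)) Q := by
    refine (lintegral_ofReal_ne_top_iff_integrable (by fun_prop)
      (ae_of_all _ fun y => (Real.exp_pos _).le)).1 hT
  have hi : Integrable X Q := by
    refine (he.const_mul l⁻¹).mono' (by fun_prop) (ae_of_all _ fun y => ?_)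
    rw [Real.norm_of_nonneg (h0 y), ← div_eq_inv_mul, le_div_iff₀ hl]
    have := Real.add_one_le_exp (l * X y)
    linarith
  rw [← ofReal_integral_eq_lintegral_ofReal hi (ae_of_all _ h0), ← ENNReal.ofReal_mul hl.le,
    ← ofReal_integral_eq_lintegral_ofReal he (ae_of_all _ fun y => (Real.exp_pos _).le),
    ENNReal.toReal_ofReal (integral_nonneg fun y => (Real.exp_pos _).le)]
  exact ENNReal.ofReal_le_ofReal (ov_jensen hi he)

lemma ov_bdd {X : T → ℝ} {Q : Measure T}
    (h0 : ∀ y, 0 ≤ X y) : IsBoundedUnder (· ≥ ·) (ae Q) X :=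
  isBoundedUnder_of_eventually_ge (a := 0) (ae_of_all _ h0)

lemma ov_cobdd {X : T → ℝ} {Q : Measure T} [IsProbabilityMeasure Q] 
     : IsCoboundedUnder (· ≥ ·) (ae Q) X := by
  by_contra h
  have h1 : ∀ n : ℕ, ∀ᵐ y ∂Q, (n : ℝ) ≤ X y := by
    intro n
    by_contra hn
    apply h
    refine ⟨n, fun a ha => ?_⟩
    by_contra hc
    push Not at hc
    exact hn (Eventually.mono (eventually_map.1 ha) fun y hy => le_trans hc.le hy)
  have h2 := ae_all_iff.2 h1
  obtain ⟨y, hy⟩ := h2.exists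
  obtain ⟨n, hn⟩ := exists_nat_gt (X y)
  exact absurd (hy n) (not_le.2 hn)

lemma ov_essInf_le {X : T → ℝ} {Q : Measure T} 
    (h0 : ∀ y, 0 ≤ X y) : ∀ᵐ y ∂Q, essInf X Q ≤ X y := ae_essInf_le (ov_bdd h0)

lemma ov_essInf_nonneg {X : T → ℝ} {Q : Measure T} [IsProbabilityMeasure Q]
    (h0 : ∀ y, 0 ≤ X y) : 0 ≤ essInf X Q :=
  le_essInf_of_ae_le 0 (ae_of_all _ h0) ov_cobdd

lemma ov_cgf_le {X : T → ℝ} {Q : Measure T} [IsProbabilityMeasure Q] (hX : Measurable X)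
    (h0 : ∀ y, 0 ≤ X y) {l : ℝ} (hl : l ≤ 0) :
    ProbabilityTheory.cgf X Q l ≤ l * essInf X Q := by
  unfold ProbabilityTheory.cgf
  rw [Real.log_le_iff_le_exp (ov_pos hX h0 hl)]
  unfold ProbabilityTheory.mgf
  calc _ ≤ ∫ y, Real.exp (l * essInf X Q) ∂Q := by
        apply integral_mono_ae (ov_int hX h0 hl) (by fun_prop)
        filter_upwards [ov_essInf_le (Q := Q) h0] with y hy
        exact Real.exp_le_exp.2 (mul_le_mul_of_nonpos_left hy hl)
    _ = _ := by simp

lemma ov_lim {X : T → ℝ} {Q : Measure T} [IsProbabilityMeasure Q] (hX : Measurable X)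
    (h0 : ∀ y, 0 ≤ X y) :
    Tendsto (fun n : ℕ => -ProbabilityTheory.cgf X Q (-((n : ℝ) + 1)) / ((n : ℝ) + 1)) atTop
      (𝓝 (essInf X Q)) := by
  have hn : ∀ n : ℕ, (0 : ℝ) < (n : ℝ) + 1 := fun n => by positivity
  rw [tendsto_order]
  constructor
  · intro a ha
    refine Eventually.of_forall fun n => ha.trans_le ?_
    rw [le_div_iff₀ (hn n)]
    have := ov_cgf_le (Q := Q) hX h0 (l := -((n : ℝ) + 1)) (by linarith [hn n])
    linarith
  · intro a ha
    obtain ⟨r, hr, hra⟩ := exists_between ha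
    have hq : 0 < Q.real {y | X y < r} := by
      rw [measureReal_def, ENNReal.toReal_pos_iff]
      refine ⟨?_, measure_lt_top _ _⟩
      rw [pos_iff_ne_zero]
      intro hz
      have : ∀ᵐ y ∂Q, r ≤ X y := by
        rw [ae_iff]; simpa using hz
      exact absurd (le_essInf_of_ae_le r this ov_cobdd) (not_le.2 hr)
    have hlim : Tendsto (fun n : ℕ => r + -Real.log (Q.real {y | X y < r}) * (1 / ((n : ℝ) + 1)))
        atTop (𝓝 (r + -Real.log (Q.real {y | X y < r}) * 0)) :=
      tendsto_const_nhds.add (tendsto_const_nhds.mul tendsto_one_div_add_atTop_nhds_zero_nat)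
    rw [mul_zero, add_zero] at hlim
    filter_upwards [hlim.eventually_lt_const hra] with n hna
    refine lt_of_le_of_lt ?_ hna
    rw [div_le_iff₀ (hn n)]
    have h1 : Real.exp (-((n : ℝ) + 1) * r) * Q.real {y | X y < r}
        ≤ ProbabilityTheory.mgf X Q (-((n : ℝ) + 1)) := by
      unfold ProbabilityTheory.mgf
      have hm : MeasurableSet {y | X y < r} := measurableSet_lt hX measurable_const
      calc _ = ∫ y, ({y | X y < r}.indicator (fun _ => Real.exp (-((n : ℝ) + 1) * r))) y ∂Q := by
            rw [integral_indicator_const _ hm, smul_eq_mul, mul_comm]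
        _ ≤ _ := by
            apply integral_mono ((integrable_const _).indicator hm)
              (ov_int hX h0 (by linarith [hn n]))
            intro y
            by_cases hy : X y < r
            · rw [indicator_of_mem (by exact hy)]
              apply Real.exp_le_exp.2
              nlinarith [hn n]
            · rw [indicator_of_notMem (by exact hy)]
              exact (Real.exp_pos _).le
    have h2 := Real.log_le_log (by positivity) h1
    rw [Real.log_mul (by positivity) hq.ne', Real.log_exp] at h2
    unfold ProbabilityTheory.cgf
    have : (r + -Real.log (Q.real {y | X y < r}) * (1 / ((n : ℝ) + 1))) * ((n : ℝ) + 1)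
      = r * ((n : ℝ) + 1) - Real.log (Q.real {y | X y < r}) := by
      have := (hn n).ne'
      field_simp
      ring
    rw [this]
    linarith

lemma ov_eq {X : T → ℝ} {Q : Measure T} [IsProbabilityMeasure Q] (hX : Measurable X)
    (h0 : ∀ y, 0 ≤ X y) {l l' : ℝ} (hll : l < l') (hl' : l' ≤ 0)
    (h : ProbabilityTheory.cgf X Q ((l + l') / 2)
      = (ProbabilityTheory.cgf X Q l + ProbabilityTheory.cgf X Q l') / 2) (t : ℝ) :
    ProbabilityTheory.cgf X Q t = t * essInf X Q := by
  have hl : l ≤ 0 := hll.le.trans hl'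
  set A := ProbabilityTheory.cgf X Q l with hA
  set B := ProbabilityTheory.cgf X Q l' with hB
  have iA := ov_int (Q := Q) hX h0 hl
  have iB := ov_int (Q := Q) hX h0 hl'
  have hs : (l + l') / 2 ≤ 0 := by linarith
  have iC := ov_int (Q := Q) hX h0 hs
  have eA : ∫ y, Real.exp (l * X y) ∂Q = Real.exp A := (ProbabilityTheory.exp_cgf iA).symm
  have eB : ∫ y, Real.exp (l' * X y) ∂Q = Real.exp B := (ProbabilityTheory.exp_cgf iB).symm
  have eC : ∫ y, Real.exp ((l + l') / 2 * X y) ∂Q = Real.exp ((A + B) / 2) := by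
    rw [← h]; exact (ProbabilityTheory.exp_cgf iC).symm
  have key : ∀ y, (Real.exp ((l * X y - A) / 2) - Real.exp ((l' * X y - B) / 2)) ^ 2
      = Real.exp (-A) * Real.exp (l * X y) + Real.exp (-B) * Real.exp (l' * X y)
        - 2 * Real.exp (-((A + B) / 2)) * Real.exp ((l + l') / 2 * X y) := by
    intro y
    rw [sub_sq, ← Real.exp_nat_mul, ← Real.exp_nat_mul, mul_assoc 2, mul_assoc 2, ← Real.exp_add,
      ← Real.exp_add, ← Real.exp_add, ← Real.exp_add]
    have e1 : ((2 : ℕ) : ℝ) * ((l * X y - A) / 2) = -A + l * X y := by push_cast; ring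
    have e2 : ((2 : ℕ) : ℝ) * ((l' * X y - B) / 2) = -B + l' * X y := by push_cast; ring
    have e3 : (l * X y - A) / 2 + (l' * X y - B) / 2 = -((A + B) / 2) + (l + l') / 2 * X y := by ring
    rw [e1, e2, e3]; ring
  have hI : Integrable (fun y => (Real.exp ((l * X y - A) / 2) - Real.exp ((l' * X y - B) / 2)) ^ 2)
      Q := by
    simp_rw [key]
    exact ((iA.const_mul _).add (iB.const_mul _)).sub (iC.const_mul _)
  have hz : ∫ y, (Real.exp ((l * X y - A) / 2) - Real.exp ((l' * X y - B) / 2)) ^ 2 ∂Q = 0 := by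
    simp_rw [key]
    have i1 : Integrable (fun y => Real.exp (-A) * Real.exp (l * X y)
        + Real.exp (-B) * Real.exp (l' * X y)) Q := (iA.const_mul _).add (iB.const_mul _)
    rw [integral_sub i1 (iC.const_mul _),
      integral_add (iA.const_mul _) (iB.const_mul _), integral_const_mul, integral_const_mul,
      integral_const_mul, eA, eB, eC, mul_assoc, ← Real.exp_add, ← Real.exp_add, ← Real.exp_add]
    norm_num
  rw [integral_eq_zero_iff_of_nonneg (fun y => sq_nonneg _) hI] at hz
  have hc : X =ᵐ[Q] fun _ => (A - B) / (l - l') := by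
    filter_upwards [hz] with y hy
    have h3 : Real.exp ((l * X y - A) / 2) - Real.exp ((l' * X y - B) / 2) = 0 := by
      simpa using hy
    have h4 := Real.exp_injective (sub_eq_zero.1 h3)
    rw [eq_div_iff (by linarith)]
    linarith
  have he : essInf X Q = (A - B) / (l - l') := by
    rw [essInf_congr_ae hc, essInf_const']
  rw [he]
  unfold ProbabilityTheory.cgf
  rw [ProbabilityTheory.mgf_congr hc]
  have := ProbabilityTheory.cgf_const (μ := Q) (t := t) ((A - B) / (l - l'))
  exact this

end OneVar
lemma conj_abs (L : ℝ → ℝ) (E : ℝ)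
    (hconv : ∀ l l' a b : ℝ, l ≤ 0 → l' ≤ 0 → 0 ≤ a → 0 ≤ b → a + b = 1 →
      L (a * l + b * l') ≤ a * L l + b * L l')
    (hcont : ContinuousOn L (Iic 0)) (hL0 : L 0 = 0)
    (hco : ∀ D, E < D → ∃ l0 < 0, l0 * D < L l0)
    (huniq : ∀ l l', l < l' → l' ≤ 0 → L ((l + l') / 2) = (L l + L l') / 2 →
      ∀ t ≤ 0, L t = t * E) :
    ∃ f : ℝ → ℝ, (∀ D, E < D → f D ≤ 0 ∧ ∀ l ≤ 0, l * D - L l ≤ f D * D - L (f D)) ∧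
      ContinuousOn f (Ioi E) ∧
      ∀ D, E < D → HasDerivAt (fun D => f D * D - L (f D)) (f D) D := by
  have hex : ∀ D, ∃ m, E < D → m ≤ 0 ∧ ∀ l ≤ 0, l * D - L l ≤ m * D - L m := by
    intro D
    by_cases hD : E < D
    swap
    · exact ⟨0, fun h => absurd h hD⟩
    obtain ⟨l0, hl0, hl0'⟩ := hco D hD
    have hc : ContinuousOn (fun l => l * D - L l) (Icc l0 0) :=
      (by fun_prop : ContinuousOn (fun l : ℝ => l * D) (Icc l0 0)).sub
        (hcont.mono Icc_subset_Iic_self)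
    obtain ⟨m, hm, hmax⟩ := isCompact_Icc.exists_isMaxOn (nonempty_Icc.2 hl0.le) hc
    refine ⟨m, fun _ => ⟨hm.2, fun l hl => ?_⟩⟩
    have h00 : 0 ≤ m * D - L m := by
      have := hmax (show (0 : ℝ) ∈ Icc l0 0 from ⟨hl0.le, le_rfl⟩)
      simpa [hL0] using this
    rcases le_total l0 l with h | h
    · exact hmax (show l ∈ Icc l0 0 from ⟨h, hl⟩)
    · have hlneg : l < 0 := h.trans_lt hl0
      have hs : 0 < l0 / l := div_pos_of_neg_of_neg hl0 hlneg
      have hs1 : l0 / l ≤ 1 := by rw [div_le_one_of_neg hlneg]; exact h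
      have := hconv l 0 (l0 / l) (1 - l0 / l) hl le_rfl hs.le (by linarith) (by ring)
      simp only [hL0, mul_zero, add_zero, div_mul_cancel₀ _ hlneg.ne] at this
      have h2 : l0 = l0 / l * l := (div_mul_cancel₀ _ hlneg.ne).symm
      have h3 : l0 / l * (l * D - L l) < 0 := by
        have : l0 / l * (l * D - L l) = l0 * D - l0 / l * L l := by
          rw [mul_sub, ← mul_assoc, ← h2]
        linarith
      have h4 : l * D - L l < 0 := by
        by_contra hcon
        push Not at hcon
        exact absurd (mul_nonneg hs.le hcon) (not_le.2 h3)
      linarith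
  choose f hf using hex
  have hstrict : ∀ D, E < D → ∀ a ≤ 0, a ≠ f D → a * D - L a < f D * D - L (f D) := by
    intro D hD a ha hne
    refine lt_of_le_of_ne ((hf D hD).2 a ha) fun heq => ?_
    have main : ∀ l l', l < l' → l' ≤ 0 → l * D - L l = f D * D - L (f D) →
        l' * D - L l' = f D * D - L (f D) → False := by
      intro l l' hll hl' h1 h2
      have h3 := (hf D hD).2 ((l + l') / 2) (by linarith)
      have h4 := hconv l l' (1 / 2) (1 / 2) (by linarith) hl' (by norm_num) (by norm_num)
        (by norm_num)
      have e : 1 / 2 * l + 1 / 2 * l' = (l + l') / 2 := by ring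
      rw [e] at h4
      have h5 := huniq l l' hll hl' (by linarith)
      rw [h5 l (by linarith)] at h1
      rw [h5 l' hl'] at h2
      nlinarith
    rcases lt_or_gt_of_ne hne with h | h
    · exact main a (f D) h (hf D hD).1 heq rfl
    · exact main (f D) a h ha rfl heq
  have hcf : ContinuousOn f (Ioi E) := by
    intro D hD
    have hD' : E < D := hD
    apply ContinuousAt.continuousWithinAt
    have hev : ∀ᶠ D' in 𝓝 D, E < D' := lt_mem_nhds hD'
    unfold ContinuousAt

    have step : ∀ a ≤ 0, a ≠ f D → ∀ᶠ D' in 𝓝 D, a * D' - L a < f D * D' - L (f D) := by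
      intro a ha hne
      exact (Continuous.tendsto (by fun_prop) D).eventually_lt (Continuous.tendsto (by fun_prop) D)
        (hstrict D hD a ha hne)
    have conv3 : ∀ D', E < D' → ∀ a s, 0 ≤ s → s ≤ 1 → a = s * f D + (1 - s) * f D' →
        a * D' - L a < f D * D' - L (f D) → False := by
      intro D' hE a s hs hs1 ha hlt
      have h1 := hconv (f D) (f D') s (1 - s) (hf D hD).1 (hf D' hE).1 hs (by linarith) (by ring)
      rw [← ha] at h1
      have h2 := (hf D' hE).2 (f D) (hf D hD).1
      have h3 : a * D' = s * (f D * D') + (1 - s) * (f D' * D') := by rw [ha]; ring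
      nlinarith
    rw [tendsto_order]
    constructor
    · intro a ha
      filter_upwards [hev, step a (ha.le.trans (hf D hD).1) ha.ne] with D' hE hlt
      by_contra hcon
      push Not at hcon
      have hpos : 0 < f D - f D' := by linarith
      refine conv3 D' hE a ((a - f D') / (f D - f D')) (by apply div_nonneg <;> linarith)
        (by rw [div_le_one hpos]; linarith) ?_ hlt
      field_simp
      ring
    · intro a ha
      by_cases ha0 : a ≤ 0
      · filter_upwards [hev, step a ha0 ha.ne'] with D' hE hlt
        by_contra hcon
        push Not at hcon
        have hpos : 0 < f D' - f D := by linarith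
        refine conv3 D' hE a ((f D' - a) / (f D' - f D)) (by apply div_nonneg <;> linarith)
          (by rw [div_le_one hpos]; linarith) ?_ hlt
        field_simp
        ring
      · filter_upwards [hev] with D' hE
        have := (hf D' hE).1
        linarith
  refine ⟨f, hf, hcf, fun D hD => ?_⟩
  rw [hasDerivAt_iff_isLittleO, Asymptotics.isLittleO_iff]
  intro c hc
  have hca : ContinuousAt f D := hcf.continuousAt (Ioi_mem_nhds hD)
  have h1 : ∀ᶠ D' in 𝓝 D, |f D' - f D| < c := by
    have := Metric.tendsto_nhds.1 hca c hc
    simpa [Real.dist_eq] using this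
  filter_upwards [h1, lt_mem_nhds hD] with D' h2 hE
  have h3 := (hf D' hE).2 (f D) (hf D hD).1
  have h4 := (hf D hD).2 (f D') (hf D' hE).1
  rw [smul_eq_mul, Real.norm_eq_abs, Real.norm_eq_abs, abs_of_nonneg (by nlinarith)]
  calc _ ≤ (f D' - f D) * (D' - D) := by nlinarith
    _ ≤ |f D' - f D| * |D' - D| := by rw [← abs_mul]; exact le_abs_self _
    _ ≤ _ := by gcongr
/-- Negative of `Λ(P,Q,l)` for `l ≤ 0`, as an extended nonnegative number. -/
def Gam {S T : Type*} [MeasurableSpace S] [MeasurableSpace T]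
    (ρ : S × T → ℝ) (P : Measure S) (Q : Measure T) (l : ℝ) : ℝ≥0∞ :=
  ∫⁻ x, ENNReal.ofReal (-ProbabilityTheory.cgf (fun y => ρ (x, y)) Q l) ∂P

lemma ereal_coe_toReal {x : ℝ≥0∞} (h : x ≠ ⊤) : ((x.toReal : ℝ) : EReal) = (x : EReal) := by
  lift x to ℝ≥0 using h
  rfl

set_option linter.unusedSectionVars false

section TwoVar

variable {S T : Type*} [MeasurableSpace S] [MeasurableSpace T]
  {ρ : S × T → ℝ} {P : Measure S} {Q : Measure T} [IsProbabilityMeasure P] [IsProbabilityMeasure Q]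

lemma Gam_zero : Gam ρ P Q 0 = 0 := by
  simp [Gam]

lemma Lam_zero : Lam ρ P Q 0 = 0 := by
  simp [Lam, posLog]

lemma Lam_eq (hρm : Measurable ρ) (hρ0 : ∀ z, 0 ≤ ρ z) {l : ℝ} (hl : l ≤ 0) :
    Lam ρ P Q l = -((Gam ρ P Q l : ℝ≥0∞) : EReal) := by
  rcases hl.eq_or_lt with rfl | hl'
  · rw [Lam_zero, Gam_zero]; simp
  · unfold Lam Gam
    rw [if_neg (not_le.2 hl')]
    congr 2
    apply lintegral_congr
    intro x
    exact ov_negLog (X := fun y => ρ (x, y)) (by fun_prop) (fun y => hρ0 _) hl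

lemma term_eq (hρm : Measurable ρ) (hρ0 : ∀ z, 0 ≤ ρ z) {l : ℝ} (hl : l ≤ 0) (D : ℝ) :
    ((l * D : ℝ) : EReal) - Lam ρ P Q l = ((l * D : ℝ) : EReal) + ((Gam ρ P Q l : ℝ≥0∞) : EReal) := by
  rw [Lam_eq hρm hρ0 hl, sub_eq_add_neg, neg_neg]

lemma lstar_eq (hρm : Measurable ρ) (hρ0 : ∀ z, 0 ≤ ρ z) (D : ℝ) :
    LamStar ρ P Q D
      = ⨆ l ∈ Iic (0 : ℝ), (((l * D : ℝ) : EReal) + ((Gam ρ P Q l : ℝ≥0∞) : EReal)) := by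
  unfold LamStar
  refine iSup_congr fun l => iSup_congr fun hl => ?_
  exact term_eq hρm hρ0 hl D

lemma le_lstar (hρm : Measurable ρ) (hρ0 : ∀ z, 0 ≤ ρ z) {l : ℝ} (hl : l ≤ 0) (D : ℝ) :
    ((l * D : ℝ) : EReal) + ((Gam ρ P Q l : ℝ≥0∞) : EReal) ≤ LamStar ρ P Q D := by
  rw [lstar_eq hρm hρ0]
  exact le_iSup₂ (f := fun l (_ : l ∈ Iic (0 : ℝ)) =>
    (((l * D : ℝ) : EReal) + ((Gam ρ P Q l : ℝ≥0∞) : EReal))) l hl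

lemma lstar_nonneg (hρm : Measurable ρ) (hρ0 : ∀ z, 0 ≤ ρ z) (D : ℝ) : 0 ≤ LamStar ρ P Q D := by
  have := le_lstar (P := P) (Q := Q) hρm hρ0 le_rfl D
  simpa [Gam_zero] using this

lemma lstar_le (hρm : Measurable ρ) (hρ0 : ∀ z, 0 ≤ ρ z) {D : ℝ} {c : EReal}
    (h : ∀ l ≤ 0, ((l * D : ℝ) : EReal) + ((Gam ρ P Q l : ℝ≥0∞) : EReal) ≤ c) :
    LamStar ρ P Q D ≤ c := by
  rw [lstar_eq hρm hρ0]
  exact iSup₂_le h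

lemma lstar_top (hρm : Measurable ρ) (hρ0 : ∀ z, 0 ≤ ρ z) {l : ℝ} (hl : l ≤ 0)
    (h : Gam ρ P Q l = ⊤) (D : ℝ) : LamStar ρ P Q D = ⊤ := by
  have := le_lstar (P := P) (Q := Q) hρm hρ0 hl D
  rw [h, EReal.coe_ennreal_top, EReal.coe_add_top] at this
  exact top_le_iff.1 this

lemma term_real {l : ℝ} (h : Gam ρ P Q l ≠ ⊤) (D : ℝ) :
    ((l * D : ℝ) : EReal) + ((Gam ρ P Q l : ℝ≥0∞) : EReal)
      = ((l * D + (Gam ρ P Q l).toReal : ℝ) : EReal) := by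
  rw [EReal.coe_add, ereal_coe_toReal h]

lemma lstar_convex (hρm : Measurable ρ) (hρ0 : ∀ z, 0 ≤ ρ z) (D₁ D₂ t : ℝ) (h0 : 0 < t)
    (h1 : t < 1) :
      LamStar ρ P Q (t * D₁ + (1 - t) * D₂) ≤
        ((t : ℝ) : EReal) * LamStar ρ P Q D₁ + (((1 - t : ℝ)) : EReal) * LamStar ρ P Q D₂ := by
  have h1' : 0 < 1 - t := by linarith
  apply lstar_le hρm hρ0
  intro l hl
  by_cases h : Gam ρ P Q l = ⊤
  · rw [lstar_top hρm hρ0 hl h, lstar_top hρm hρ0 hl h, EReal.coe_mul_top_of_pos h0,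
      EReal.coe_mul_top_of_pos h1']
    exact le_top
  · have a1 := le_lstar (P := P) (Q := Q) hρm hρ0 hl D₁
    have a2 := le_lstar (P := P) (Q := Q) hρm hρ0 hl D₂
    rw [term_real h] at a1 a2 ⊢
    have b1 := mul_le_mul_of_nonneg_left a1 (show (0 : EReal) ≤ (t : EReal) by exact_mod_cast h0.le)
    have b2 := mul_le_mul_of_nonneg_left a2
      (show (0 : EReal) ≤ ((1 - t : ℝ) : EReal) by exact_mod_cast h1'.le)
    refine le_trans ?_ (add_le_add b1 b2)
    rw [← EReal.coe_mul, ← EReal.coe_mul, ← EReal.coe_add, EReal.coe_le_coe_iff]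
    apply le_of_eq; ring

lemma lstar_lsc (hρm : Measurable ρ) (hρ0 : ∀ z, 0 ≤ ρ z) :
    LowerSemicontinuous (LamStar ρ P Q) := by
  have : LamStar ρ P Q = fun D => ⨆ l, ⨆ (_ : l ∈ Iic (0 : ℝ)),
      (((l * D : ℝ) : EReal) + ((Gam ρ P Q l : ℝ≥0∞) : EReal)) := by
    funext D; exact lstar_eq hρm hρ0 D
  rw [this]
  refine lowerSemicontinuous_biSup (fun l hl => ?_)
  apply Continuous.lowerSemicontinuous
  by_cases h : Gam ρ P Q l = ⊤
  · rw [h]; simp only [EReal.coe_ennreal_top, EReal.coe_add_top]; exact continuous_const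
  · simp_rw [term_real h]
    exact continuous_coe_real_ereal.comp (by fun_prop)

lemma lstar_anti (hρm : Measurable ρ) (hρ0 : ∀ z, 0 ≤ ρ z) : Antitone (LamStar ρ P Q) := by
  intro D D' h
  apply lstar_le hρm hρ0
  intro l hl
  refine le_trans ?_ (le_lstar hρm hρ0 hl D)
  exact add_le_add (EReal.coe_le_coe_iff.2 (mul_le_mul_of_nonpos_left h hl)) le_rfl

lemma lstar_right (hρm : Measurable ρ) (hρ0 : ∀ z, 0 ≤ ρ z) (D : ℝ) :
    Tendsto (LamStar ρ P Q) (𝓝[>] D) (𝓝 (LamStar ρ P Q D)) := by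
  rw [tendsto_order]
  constructor
  · intro a ha
    exact ((lstar_lsc hρm hρ0) D a ha).filter_mono nhdsWithin_le_nhds
  · intro a ha
    filter_upwards [self_mem_nhdsWithin] with D' hD'
    exact (lstar_anti hρm hρ0 (le_of_lt hD')).trans_lt ha

lemma lstar_neg (hρm : Measurable ρ) (hρ0 : ∀ z, 0 ≤ ρ z) {D : ℝ} (hD : D < 0) :
    LamStar ρ P Q D = ⊤ := by
  rw [EReal.eq_top_iff_forall_lt]
  intro c
  have h := le_lstar (P := P) (Q := Q) hρm hρ0 (l := -(|c| + 1) / -D)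
    (by apply div_nonpos_of_nonpos_of_nonneg <;> linarith [abs_nonneg c]) D
  refine lt_of_lt_of_le ?_ h
  refine lt_of_lt_of_le ?_ (le_add_of_nonneg_right (EReal.coe_ennreal_nonneg _))
  rw [EReal.coe_lt_coe_iff]
  have : -(|c| + 1) / -D * D = |c| + 1 := by
    rw [neg_div_neg_eq, div_mul_cancel₀ _ hD.ne]
  rw [this]
  linarith [le_abs_self c]

lemma lstar_lt_min (hρm : Measurable ρ) (hρ0 : ∀ z, 0 ≤ ρ z) {D : ℝ} (hD : D < DminPQ ρ P Q) :
    LamStar ρ P Q D = ⊤ := by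
  by_contra h
  refine absurd (csInf_le ?_ (show D ∈ {D : ℝ | LamStar ρ P Q D ≠ ⊤} from h)) (not_le.2 hD)
  refine ⟨0, fun d hd => ?_⟩
  by_contra hc
  exact hd (lstar_neg hρm hρ0 (not_le.1 hc))

lemma Dave_eq (hρm : Measurable ρ) :
    DavePQ ρ P Q = ∫⁻ x, ∫⁻ y, ENNReal.ofReal (ρ (x, y)) ∂Q ∂P := by
  unfold DavePQ
  rw [lintegral_prod _ (by fun_prop)]

lemma Gam_le_Dave (hρm : Measurable ρ) (hρ0 : ∀ z, 0 ≤ ρ z) {l : ℝ} (hl : l ≤ 0) :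
    Gam ρ P Q l ≤ ENNReal.ofReal (-l) * DavePQ ρ P Q := by
  rw [Dave_eq hρm, ← lintegral_const_mul' _ _ ENNReal.ofReal_ne_top]
  apply lintegral_mono
  intro x
  exact ov_jensen_neg (X := fun y => ρ (x, y)) (by fun_prop) (fun y => hρ0 _) hl

lemma lstar_ave (hρm : Measurable ρ) (hρ0 : ∀ z, 0 ≤ ρ z) {D : ℝ}
    (hD : ((DavePQ ρ P Q : ℝ≥0∞) : EReal) ≤ ((D : ℝ) : EReal)) : LamStar ρ P Q D = 0 := by
  apply le_antisymm _ (lstar_nonneg hρm hρ0 D)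
  apply lstar_le hρm hρ0
  intro l hl
  have hfin : DavePQ ρ P Q ≠ ⊤ := by
    intro h; rw [h] at hD; simp at hD
  have hD' : (DavePQ ρ P Q).toReal ≤ D := by
    rw [← ereal_coe_toReal hfin] at hD; exact_mod_cast hD
  have h1 := Gam_le_Dave (P := P) (Q := Q) hρm hρ0 hl
  have hG : Gam ρ P Q l ≠ ⊤ := ne_top_of_le_ne_top (ENNReal.mul_ne_top ENNReal.ofReal_ne_top hfin) h1
  have h2 := ENNReal.toReal_mono (ENNReal.mul_ne_top ENNReal.ofReal_ne_top hfin) h1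
  rw [ENNReal.toReal_mul, ENNReal.toReal_ofReal (by linarith)] at h2
  rw [term_real hG]
  norm_cast
  nlinarith

lemma Lam_ge_Dave (hρm : Measurable ρ) (hρ0 : ∀ z, 0 ≤ ρ z) {l : ℝ} (hl : 0 < l) :
    ((ENNReal.ofReal l * DavePQ ρ P Q : ℝ≥0∞) : EReal) ≤ Lam ρ P Q l := by
  unfold Lam
  rw [if_pos hl.le, EReal.coe_ennreal_le_coe_ennreal_iff, Dave_eq hρm,
    ← lintegral_const_mul' _ _ ENNReal.ofReal_ne_top]
  apply lintegral_mono
  intro x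
  exact ov_jensen_pos (X := fun y => ρ (x, y)) (by fun_prop) (fun y => hρ0 _) hl

lemma lstar_two (hρm : Measurable ρ) (hρ0 : ∀ z, 0 ≤ ρ z) {D : ℝ}
    (hD : ((D : ℝ) : EReal) ≤ ((DavePQ ρ P Q : ℝ≥0∞) : EReal)) :
    LamStar ρ P Q D = ⨆ l : ℝ, (((l * D : ℝ) : EReal) - Lam ρ P Q l) := by
  apply le_antisymm
  · exact iSup₂_le fun l _ => le_iSup (fun l : ℝ => (((l * D : ℝ) : EReal) - Lam ρ P Q l)) l
  · apply iSup_le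
    intro l
    rcases le_or_gt l 0 with hl | hl
    · rw [term_eq hρm hρ0 hl]; exact le_lstar hρm hρ0 hl D
    · refine le_trans ?_ (lstar_nonneg hρm hρ0 D)
      have h1 := Lam_ge_Dave (P := P) (Q := Q) hρm hρ0 hl
      refine (EReal.sub_le_sub le_rfl h1).trans ?_
      by_cases hfin : DavePQ ρ P Q = ⊤
      · rw [hfin, ENNReal.mul_top (by simpa using hl)]; simp
      · rw [← ereal_coe_toReal hfin, EReal.coe_le_coe_iff] at hD
        rw [← ereal_coe_toReal (ENNReal.mul_ne_top ENNReal.ofReal_ne_top hfin),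
          ENNReal.toReal_mul, ENNReal.toReal_ofReal hl.le]
        norm_cast
        nlinarith

end TwoVar
section Final

variable {S T : Type*} [MeasurableSpace S] [MeasurableSpace T]
  {ρ : S × T → ℝ} {P : Measure S} {Q : Measure T} [IsProbabilityMeasure P] [IsProbabilityMeasure Q]

lemma K_meas (hρm : Measurable ρ) (l : ℝ) :
    Measurable (fun x => ProbabilityTheory.cgf (fun y => ρ (x, y)) Q l) := by
  unfold ProbabilityTheory.cgf ProbabilityTheory.mgf
  apply Real.measurable_log.comp
  have : StronglyMeasurable (fun z : S × T => Real.exp (l * ρ z)) :=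
    Measurable.stronglyMeasurable (by fun_prop)
  exact (this.integral_prod_right (ν := Q)).measurable

lemma K_nonpos (hρm : Measurable ρ) (hρ0 : ∀ z, 0 ≤ ρ z) {l : ℝ} (hl : l ≤ 0) (x : S) :
    ProbabilityTheory.cgf (fun y => ρ (x, y)) Q l ≤ 0 :=
  ov_cgf_nonpos (X := fun y => ρ (x, y)) (by fun_prop) (fun y => hρ0 _) hl

lemma K_int (hρm : Measurable ρ) (hρ0 : ∀ z, 0 ≤ ρ z) {l : ℝ} (hl : l ≤ 0)
    (hG : Gam ρ P Q l ≠ ⊤) :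
    Integrable (fun x => ProbabilityTheory.cgf (fun y => ρ (x, y)) Q l) P := by
  have h1 : Integrable (fun x => -ProbabilityTheory.cgf (fun y => ρ (x, y)) Q l) P :=
    (lintegral_ofReal_ne_top_iff_integrable (K_meas hρm l).neg.aestronglyMeasurable
      (ae_of_all _ fun x => by simpa using K_nonpos hρm hρ0 hl x)).1 hG
  simpa using h1.neg

lemma Gam_toReal (hρm : Measurable ρ) (hρ0 : ∀ z, 0 ≤ ρ z) {l : ℝ} (hl : l ≤ 0) :
    (Gam ρ P Q l).toReal = - ∫ x, ProbabilityTheory.cgf (fun y => ρ (x, y)) Q l ∂P := by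
  unfold Gam
  rw [← integral_neg]
  exact (integral_eq_lintegral_of_nonneg_ae
    (f := fun x => -ProbabilityTheory.cgf (fun y => ρ (x, y)) Q l)
    (ae_of_all _ fun x => by simpa using K_nonpos hρm hρ0 hl x)
    (K_meas hρm l).neg.aestronglyMeasurable).symm

lemma rhoQ_lim (hρm : Measurable ρ) (hρ0 : ∀ z, 0 ≤ ρ z) (x : S) :
    Tendsto (fun n : ℕ => -ProbabilityTheory.cgf (fun y => ρ (x, y)) Q (-((n : ℝ) + 1)) /
      ((n : ℝ) + 1)) atTop (𝓝 (rhoQ ρ Q x)) :=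
  ov_lim (X := fun y => ρ (x, y)) (by fun_prop) (fun y => hρ0 _)

lemma rhoQ_nonneg (hρ0 : ∀ z, 0 ≤ ρ z) (x : S) : 0 ≤ rhoQ ρ Q x :=
  ov_essInf_nonneg (fun y => hρ0 _)

lemma K_le (hρm : Measurable ρ) (hρ0 : ∀ z, 0 ≤ ρ z) {l : ℝ} (hl : l ≤ 0) (x : S) :
    ProbabilityTheory.cgf (fun y => ρ (x, y)) Q l ≤ l * rhoQ ρ Q x :=
  ov_cgf_le (X := fun y => ρ (x, y)) (by fun_prop) (fun y => hρ0 _) hl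

lemma rhoQ_meas (hρm : Measurable ρ) (hρ0 : ∀ z, 0 ≤ ρ z) : Measurable (rhoQ ρ Q) := by
  refine measurable_of_tendsto_metrizable (f := fun (n : ℕ) x =>
    -ProbabilityTheory.cgf (fun y => ρ (x, y)) Q (-((n : ℝ) + 1)) / ((n : ℝ) + 1)) ?_ ?_
  · intro n
    exact (K_meas hρm _).neg.div_const _
  · rw [tendsto_pi_nhds]
    exact fun x => rhoQ_lim hρm hρ0 x

lemma final (hρm : Measurable ρ) (hρ0 : ∀ z, 0 ≤ ρ z)
    (hne : {D : ℝ | LamStar ρ P Q D ≠ ⊤}.Nonempty) :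
      ENNReal.ofReal (DminPQ ρ P Q) = (∫⁻ x, ENNReal.ofReal (rhoQ ρ Q x) ∂P) ∧
      (∀ D : ℝ, DminPQ ρ P Q < D → LamStar ρ P Q D ≠ ⊤) ∧
      ∃ f : ℝ → ℝ, ContinuousOn f (Ioi (DminPQ ρ P Q)) ∧
        ∀ D ∈ Ioi (DminPQ ρ P Q),
          HasDerivAt (fun t => (LamStar ρ P Q t).toReal) (f D) D := by
  have hG : ∀ l ≤ 0, Gam ρ P Q l ≠ ⊤ := by
    intro l hl h
    obtain ⟨D, hD⟩ := hne
    exact hD (lstar_top hρm hρ0 hl h D)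
  set K : S → ℝ → ℝ := fun x l => ProbabilityTheory.cgf (fun y => ρ (x, y)) Q l with hK
  have hKm : ∀ l, Measurable (fun x => K x l) := fun l => K_meas hρm l
  have hKi : ∀ l ≤ 0, Integrable (fun x => K x l) P := fun l hl => K_int hρm hρ0 hl (hG l hl)
  have hK0 : ∀ l ≤ 0, ∀ x, K x l ≤ 0 := fun l hl x => K_nonpos hρm hρ0 hl x
  have hKz : ∀ x, K x 0 = 0 := fun x => by simp [hK]
  have hKmono : ∀ l l', l ≤ l' → l' ≤ 0 → ∀ x, K x l ≤ K x l' := fun l l' h h' x =>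
    ov_cgf_mono (X := fun y => ρ (x, y)) (by fun_prop) (fun y => hρ0 _) h h'
  have hKc : ∀ x l l' a b, l ≤ 0 → l' ≤ 0 → 0 ≤ a → 0 ≤ b → a + b = 1 →
      K x (a * l + b * l') ≤ a * K x l + b * K x l' := fun x l l' a b hl hl' ha hb hab =>
    ov_cgf_convex (X := fun y => ρ (x, y)) (by fun_prop) (fun y => hρ0 _) hl hl' ha hb hab
  have hKcont : ∀ x, ContinuousOn (K x) (Iic 0) := fun x =>
    ov_cgf_cont (X := fun y => ρ (x, y)) (by fun_prop) (fun y => hρ0 _)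
  set L : ℝ → ℝ := fun l => ∫ x, K x l ∂P with hL
  have hterm : ∀ l ≤ 0, ∀ D : ℝ, ((l * D : ℝ) : EReal) + ((Gam ρ P Q l : ℝ≥0∞) : EReal)
      = ((l * D - L l : ℝ) : EReal) := by
    intro l hl D
    rw [term_real (hG l hl), Gam_toReal hρm hρ0 hl, sub_eq_add_neg]
  have hri : Integrable (rhoQ ρ Q) P := by
    refine (hKi (-1) (by norm_num)).neg.mono' (rhoQ_meas hρm hρ0).aestronglyMeasurable
      (ae_of_all _ fun x => ?_)
    rw [Real.norm_of_nonneg (rhoQ_nonneg hρ0 x)]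
    have := K_le (Q := Q) hρm hρ0 (l := -1) (by norm_num) x
    simp only [Pi.neg_apply, hK]
    linarith
  set E := ∫ x, rhoQ ρ Q x ∂P with hE
  have hE0 : 0 ≤ E := integral_nonneg fun x => rhoQ_nonneg hρ0 x
  have hLle : ∀ l ≤ 0, L l ≤ l * E := by
    intro l hl
    rw [hE, ← integral_const_mul]
    exact integral_mono (hKi l hl) (hri.const_mul l) fun x => K_le hρm hρ0 hl x
  have hlim : Tendsto (fun n : ℕ => -L (-((n : ℝ) + 1)) / ((n : ℝ) + 1)) atTop (𝓝 E) := by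
    have h1 : ∀ n : ℕ, -L (-((n : ℝ) + 1)) / ((n : ℝ) + 1)
        = ∫ x, -K x (-((n : ℝ) + 1)) / ((n : ℝ) + 1) ∂P := by
      intro n
      rw [integral_div, integral_neg]
    simp_rw [h1]
    refine tendsto_integral_of_dominated_convergence (fun x => -K x (-1))
      (fun n => ((hKm _).neg.div_const _).aestronglyMeasurable) (hKi (-1) (by norm_num)).neg
      (fun n => ae_of_all _ fun x => ?_) (ae_of_all _ fun x => rhoQ_lim hρm hρ0 x)
    have hn : (0 : ℝ) < (n : ℝ) + 1 := by positivity
    rw [Real.norm_of_nonneg (div_nonneg (by linarith [hK0 (-((n : ℝ) + 1)) (by linarith) x]) hn.le)]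
    have h2 := hKc x (-((n : ℝ) + 1)) 0 (1 / ((n : ℝ) + 1)) (1 - 1 / ((n : ℝ) + 1)) (by linarith)
      le_rfl (by positivity) (by
        rw [sub_nonneg, div_le_one hn]; linarith [(Nat.cast_nonneg n : (0 : ℝ) ≤ n)]) (by ring)
    have h3 : 1 / ((n : ℝ) + 1) * -((n : ℝ) + 1) + (1 - 1 / ((n : ℝ) + 1)) * 0 = -1 := by
      field_simp
      ring
    rw [h3, hKz, mul_zero, add_zero] at h2
    have h4 : -K x (-((n : ℝ) + 1)) / ((n : ℝ) + 1)
      = -(1 / ((n : ℝ) + 1) * K x (-((n : ℝ) + 1))) := by ring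
    rw [h4]
    linarith
  obtain ⟨f, hf, hfc, hfd⟩ := conj_abs L E
    (by
      intro l l' a b hl hl' ha hb hab
      have h1 : ∫ x, (a * K x l + b * K x l') ∂P = a * L l + b * L l' := by
        rw [integral_add ((hKi l hl).const_mul a) ((hKi l' hl').const_mul b), integral_const_mul,
          integral_const_mul]
      rw [← h1]
      exact integral_mono (hKi _ (by nlinarith))
        (((hKi l hl).const_mul a).add ((hKi l' hl').const_mul b))
        fun x => hKc x l l' a b hl hl' ha hb hab)
    (by
      intro l0 hl0
      have hl0' : l0 ≤ 0 := hl0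
      refine continuousWithinAt_of_dominated (bound := fun x => -K x (l0 - 1)) ?_ ?_
        (hKi (l0 - 1) (by linarith)).neg ?_
      · exact Eventually.of_forall fun l => (hKm l).aestronglyMeasurable
      · filter_upwards [self_mem_nhdsWithin,
          mem_nhdsWithin_of_mem_nhds (lt_mem_nhds (show l0 - 1 < l0 by linarith))] with l hl hl1
        refine ae_of_all _ fun x => ?_
        rw [Real.norm_of_nonpos (hK0 l hl x)]
        linarith [hKmono (l0 - 1) l hl1.le hl x]
      · exact ae_of_all _ fun x => hKcont x l0 hl0)
    (by simp [hL, hKz])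
    (by
      intro D hD
      obtain ⟨n, hn⟩ := (hlim.eventually_lt_const hD).exists
      have hn0 : (0 : ℝ) < (n : ℝ) + 1 := by positivity
      refine ⟨-((n : ℝ) + 1), by linarith, ?_⟩
      rw [div_lt_iff₀ hn0] at hn
      linarith)
    (by
      intro l l' hll hl' heq t ht
      have hl : l ≤ 0 := by linarith
      have hs : (l + l') / 2 ≤ 0 := by linarith
      have hi1 : Integrable (fun x => (K x l + K x l') / 2) P :=
        ((hKi l hl).add (hKi l' hl')).div_const 2
      have hi : Integrable (fun x => (K x l + K x l') / 2 - K x ((l + l') / 2)) P :=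
        hi1.sub (hKi _ hs)
      have hz : ∫ x, ((K x l + K x l') / 2 - K x ((l + l') / 2)) ∂P = 0 := by
        rw [integral_sub hi1 (hKi _ hs), integral_div, integral_add (hKi l hl) (hKi l' hl')]
        simp only [hL] at heq
        linarith
      rw [integral_eq_zero_iff_of_nonneg _ hi] at hz
      · rw [hE, ← integral_const_mul]
        apply integral_congr_ae
        filter_upwards [hz] with x hx
        have hx' : (K x l + K x l') / 2 - K x ((l + l') / 2) = 0 := hx
        exact ov_eq (X := fun y => ρ (x, y)) (by fun_prop) (fun y => hρ0 _) hll hl'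
          (by linarith) t
      · intro x
        have := hKc x l l' (1 / 2) (1 / 2) hl hl' (by norm_num) (by norm_num) (by norm_num)
        have e : 1 / 2 * l + 1 / 2 * l' = (l + l') / 2 := by ring
        rw [e] at this
        simp only [Pi.zero_apply]
        linarith)
  have hstar : ∀ D, E < D → LamStar ρ P Q D = ((f D * D - L (f D) : ℝ) : EReal) := by
    intro D hD
    apply le_antisymm
    · apply lstar_le hρm hρ0
      intro l hl
      rw [hterm l hl, EReal.coe_le_coe_iff]
      exact (hf D hD).2 l hl
    · rw [← hterm _ (hf D hD).1]
      exact le_lstar hρm hρ0 (hf D hD).1 D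
  have hfin : ∀ D, E < D → LamStar ρ P Q D ≠ ⊤ := by
    intro D hD
    rw [hstar D hD]
    exact EReal.coe_ne_top _
  have hinf : ∀ D, D < E → LamStar ρ P Q D = ⊤ := by
    intro D hD
    rw [EReal.eq_top_iff_forall_lt]
    intro c
    have hp : 0 < E - D := by linarith
    have hl : -((|c| + 1) / (E - D)) ≤ 0 := by
      have : 0 ≤ (|c| + 1) / (E - D) := by positivity
      linarith
    have h := le_lstar (P := P) (Q := Q) hρm hρ0 hl D
    rw [hterm _ hl] at h
    refine lt_of_lt_of_le ?_ h
    rw [EReal.coe_lt_coe_iff]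
    have h1 := hLle _ hl
    have h2 : -((|c| + 1) / (E - D)) * D - -((|c| + 1) / (E - D)) * E = |c| + 1 := by
      field_simp
      ring
    linarith [le_abs_self c]
  have hmin : DminPQ ρ P Q = E := by
    unfold DminPQ
    apply le_antisymm
    · apply le_of_forall_gt_imp_ge_of_dense
      intro D hD
      refine csInf_le ⟨E, fun d hd => ?_⟩ (hfin D hD)
      by_contra hc
      exact hd (hinf d (not_le.1 hc))
    · refine le_csInf hne fun d hd => ?_
      by_contra hc
      exact hd (hinf d (not_le.1 hc))
  rw [hmin]
  refine ⟨?_, hfin, f, hfc, fun D hD => ?_⟩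
  · rw [hE, ofReal_integral_eq_lintegral_ofReal hri (ae_of_all _ fun x => rhoQ_nonneg hρ0 x)]
  · refine (hfd D hD).congr_of_eventuallyEq ?_
    filter_upwards [lt_mem_nhds (show E < D from hD)] with D' hD'
    rw [hstar D' hD', EReal.toReal_coe]

end Final

/-- `Λ*(P,Q,·)` is convex, lower semicontinuous, nonnegative,
nonincreasing and right-continuous; it is `+∞` on `(-∞, D_min)` and `0` on `[D_ave, ∞)`;
for `D ≤ D_ave` the one-sided transform agrees with the two-sided one; and if
`D_min < ∞` then `D_min = Eρ_Q(X)` and `Λ*(P,Q,·)` is finite and `C¹` on `(D_min,∞)`. -/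
theorem stmt5 {S T : Type*} [MeasurableSpace S] [StandardBorelSpace S]
    [MeasurableSpace T] [StandardBorelSpace T]
    (ρ : S × T → ℝ) (hρm : Measurable ρ) (hρ0 : ∀ z, 0 ≤ ρ z)
    (P : Measure S) (Q : Measure T) [IsProbabilityMeasure P] [IsProbabilityMeasure Q] :
    (∀ D₁ D₂ t : ℝ, 0 < t → t < 1 →
      LamStar ρ P Q (t * D₁ + (1 - t) * D₂) ≤
        ((t : ℝ) : EReal) * LamStar ρ P Q D₁ + (((1 - t : ℝ)) : EReal) * LamStar ρ P Q D₂) ∧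
    LowerSemicontinuous (LamStar ρ P Q) ∧
    (∀ D : ℝ, 0 ≤ LamStar ρ P Q D) ∧
    Antitone (LamStar ρ P Q) ∧
    (∀ D : ℝ, Tendsto (LamStar ρ P Q) (𝓝[>] D) (𝓝 (LamStar ρ P Q D))) ∧
    (∀ D : ℝ, D < DminPQ ρ P Q → LamStar ρ P Q D = ⊤) ∧
    (∀ D : ℝ, ((DavePQ ρ P Q : ℝ≥0∞) : EReal) ≤ ((D : ℝ) : EReal) → LamStar ρ P Q D = 0) ∧
    (∀ D : ℝ, ((D : ℝ) : EReal) ≤ ((DavePQ ρ P Q : ℝ≥0∞) : EReal) →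
      LamStar ρ P Q D = ⨆ l : ℝ, (((l * D : ℝ) : EReal) - Lam ρ P Q l)) ∧
    ({D : ℝ | LamStar ρ P Q D ≠ ⊤}.Nonempty →
      ENNReal.ofReal (DminPQ ρ P Q) = (∫⁻ x, ENNReal.ofReal (rhoQ ρ Q x) ∂P) ∧
      (∀ D : ℝ, DminPQ ρ P Q < D → LamStar ρ P Q D ≠ ⊤) ∧
      ∃ f : ℝ → ℝ, ContinuousOn f (Ioi (DminPQ ρ P Q)) ∧
        ∀ D ∈ Ioi (DminPQ ρ P Q),
          HasDerivAt (fun t => (LamStar ρ P Q t).toReal) (f D) D) := by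
  refine ⟨lstar_convex hρm hρ0, lstar_lsc hρm hρ0, lstar_nonneg hρm hρ0, lstar_anti hρm hρ0,
    lstar_right hρm hρ0, fun D hD => lstar_lt_min hρm hρ0 hD, fun D hD => lstar_ave hρm hρ0 hD,
    fun D hD => lstar_two hρm hρ0 hD, fun hne => final hρm hρ0 hne⟩

end
end

section
/- Suppose D_min := inf{D : Λ*(P,Q,D) < ∞} is finite and D_min < D_ave := E ρ(X,Y). Then Λ*(P,Q,·) is strictly convex (hence strictly decreasing) on (D_min, D_ave), and for each D ∈ (D_min, D_ave) there exists a unique λ_D < 0 such that Λ*(P,Q,D) = λ_D · D − Λ(P,Q,λ_D). -/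
open MeasureTheory Filter Set Topology Classical
open scoped ENNReal NNReal

noncomputable section

section Helpers
open ProbabilityTheory

lemma aux_int {T : Type*} [MeasurableSpace T] (Q : Measure T) [IsProbabilityMeasure Q]
    (X : T → ℝ) (hX : Measurable X) (h0 : ∀ y, 0 ≤ X y) {l : ℝ} (hl : l ≤ 0) :
    Integrable (fun y => Real.exp (l * X y)) Q := by
  refine Integrable.of_bound (C := 1) (by fun_prop) (ae_of_all _ fun y => ?_)
  rw [Real.norm_eq_abs, abs_of_pos (Real.exp_pos _), Real.exp_le_one_iff]
  exact mul_nonpos_of_nonpos_of_nonneg hl (h0 y)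

lemma aux_mgf_pos {T : Type*} [MeasurableSpace T] (Q : Measure T) [IsProbabilityMeasure Q]
    (X : T → ℝ) (hX : Measurable X) (h0 : ∀ y, 0 ≤ X y) {l : ℝ} (hl : l ≤ 0) :
    0 < mgf X Q l := mgf_pos (aux_int Q X hX h0 hl)

lemma aux_mgf_mono {T : Type*} [MeasurableSpace T] (Q : Measure T) [IsProbabilityMeasure Q]
    (X : T → ℝ) (hX : Measurable X) (h0 : ∀ y, 0 ≤ X y) {l m : ℝ} (hlm : l ≤ m) (hl : m ≤ 0) :
    mgf X Q l ≤ mgf X Q m := by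
  refine integral_mono (aux_int Q X hX h0 (hlm.trans hl)) (aux_int Q X hX h0 hl) fun y => ?_
  exact Real.exp_le_exp.2 (mul_le_mul_of_nonneg_right hlm (h0 y))

lemma aux_cgf_mono {T : Type*} [MeasurableSpace T] (Q : Measure T) [IsProbabilityMeasure Q]
    (X : T → ℝ) (hX : Measurable X) (h0 : ∀ y, 0 ≤ X y) {l m : ℝ} (hlm : l ≤ m) (hl : m ≤ 0) :
    cgf X Q l ≤ cgf X Q m :=
  Real.log_le_log (aux_mgf_pos Q X hX h0 (hlm.trans hl)) (aux_mgf_mono Q X hX h0 hlm hl)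

lemma aux_cgf_nonpos {T : Type*} [MeasurableSpace T] (Q : Measure T) [IsProbabilityMeasure Q]
    (X : T → ℝ) (hX : Measurable X) (h0 : ∀ y, 0 ≤ X y) {l : ℝ} (hl : l ≤ 0) :
    cgf X Q l ≤ 0 := by
  simpa using aux_cgf_mono Q X hX h0 hl le_rfl

lemma aux_interior {T : Type*} [MeasurableSpace T] (Q : Measure T) [IsProbabilityMeasure Q]
    (X : T → ℝ) (hX : Measurable X) (h0 : ∀ y, 0 ≤ X y) {l : ℝ} (hl : l < 0) :
    l ∈ interior (integrableExpSet X Q) := by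
  rw [mem_interior]
  exact ⟨Iio 0, fun m hm => aux_int Q X hX h0 (le_of_lt hm), isOpen_Iio, hl⟩

lemma aux_cgf_deriv {T : Type*} [MeasurableSpace T] (Q : Measure T) [IsProbabilityMeasure Q]
    (X : T → ℝ) (hX : Measurable X) (h0 : ∀ y, 0 ≤ X y) {l : ℝ} (hl : l < 0) :
    HasDerivAt (cgf X Q) ((∫ y, X y * Real.exp (l * X y) ∂Q) / mgf X Q l) l := by
  have h := aux_interior Q X hX h0 hl
  exact (hasDerivAt_mgf h).log (aux_mgf_pos Q X hX h0 hl.le).ne'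

lemma aux_cgf_cont {T : Type*} [MeasurableSpace T] (Q : Measure T) [IsProbabilityMeasure Q]
    (X : T → ℝ) (hX : Measurable X) (h0 : ∀ y, 0 ≤ X y) :
    ContinuousOn (cgf X Q) (Iic 0) := by
  have : ContinuousOn (mgf X Q) (Iic 0) := by
    refine continuousOn_of_dominated (bound := fun _ => 1) (fun l _ => by fun_prop)
      (fun l hl => ae_of_all _ fun y => ?_) (integrable_const _)
      (ae_of_all _ fun y => by fun_prop)
    rw [Real.norm_eq_abs, abs_of_pos (Real.exp_pos _), Real.exp_le_one_iff]
    exact mul_nonpos_of_nonpos_of_nonneg hl (h0 y)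
  exact this.log fun l hl => (aux_mgf_pos Q X hX h0 hl).ne'

lemma aux_deriv_bound {T : Type*} [MeasurableSpace T] (Q : Measure T) [IsProbabilityMeasure Q]
    (X : T → ℝ) (hX : Measurable X) (h0 : ∀ y, 0 ≤ X y) {l : ℝ} (hl : l < 0) :
    (-l) * ((∫ y, X y * Real.exp (l * X y) ∂Q) / mgf X Q l) ≤ - cgf X Q l := by
  have hM := aux_mgf_pos Q X hX h0 hl.le
  have hE := aux_int Q X hX h0 hl.le
  have hi : Integrable (fun y => X y * Real.exp (l * X y)) Q := by
    simpa using integrable_pow_mul_exp_of_mem_interior_integrableExpSet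
      (aux_interior Q X hX h0 hl) 1
  have key : ∫ y, (-l) * (X y * Real.exp (l * X y)) ∂Q ≤
      ∫ y, ((- cgf X Q l - 1) * Real.exp (l * X y) + mgf X Q l) ∂Q := by
    refine integral_mono (hi.const_mul _) ((hE.const_mul _).add (integrable_const _)) fun y => ?_
    have h1 := Real.add_one_le_exp (cgf X Q l - l * X y)
    rw [Real.exp_sub, exp_cgf hE, le_div_iff₀ (Real.exp_pos _)] at h1
    dsimp only
    nlinarith
  rw [integral_const_mul, integral_add (hE.const_mul _) (integrable_const _),
    integral_const_mul] at key
  simp only [integral_const, probReal_univ, one_smul] at key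
  change _ ≤ (- cgf X Q l - 1) * mgf X Q l + mgf X Q l at key
  rw [← mul_div_assoc, div_le_iff₀ hM]
  linarith

/-- Midpoint convexity of the cgf, with the equality case. -/
lemma aux_mid {T : Type*} [MeasurableSpace T] (Q : Measure T) [IsProbabilityMeasure Q]
    (X : T → ℝ) (hX : Measurable X) (h0 : ∀ y, 0 ≤ X y) {l m : ℝ} (hlm : l < m) (hm : m ≤ 0) :
    2 * cgf X Q ((l + m) / 2) ≤ cgf X Q l + cgf X Q m ∧
    (2 * cgf X Q ((l + m) / 2) = cgf X Q l + cgf X Q m → ∃ c, X =ᵐ[Q] fun _ => c) := by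
  have hl : l ≤ 0 := hlm.le.trans hm
  have hn : (l + m) / 2 ≤ 0 := by linarith
  have hEl := aux_int Q X hX h0 hl
  have hEm := aux_int Q X hX h0 hm
  have hEn := aux_int Q X hX h0 hn
  set a := cgf X Q l with ha
  set b := cgf X Q m with hb
  set c := cgf X Q ((l + m) / 2) with hc
  have hfe : ∀ y, (Real.exp ((l * X y - a) / 2) - Real.exp ((m * X y - b) / 2)) ^ 2 =
      Real.exp (-a) * Real.exp (l * X y) + Real.exp (-b) * Real.exp (m * X y)
        - 2 * Real.exp (-(a + b) / 2) * Real.exp ((l + m) / 2 * X y) := by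
    intro y
    have e1 : Real.exp ((l * X y - a) / 2) ^ 2 = Real.exp (-a) * Real.exp (l * X y) := by
      rw [← Real.exp_nat_mul, ← Real.exp_add]; congr 1; push_cast; ring
    have e2 : Real.exp ((m * X y - b) / 2) ^ 2 = Real.exp (-b) * Real.exp (m * X y) := by
      rw [← Real.exp_nat_mul, ← Real.exp_add]; congr 1; push_cast; ring
    have e3 : Real.exp ((l * X y - a) / 2) * Real.exp ((m * X y - b) / 2) =
        Real.exp (-(a + b) / 2) * Real.exp ((l + m) / 2 * X y) := by
      rw [← Real.exp_add, ← Real.exp_add]; congr 1; ring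
    rw [sub_sq, e1, e2, mul_assoc, e3]; ring
  have hI : Integrable (fun y => (Real.exp ((l * X y - a) / 2) -
      Real.exp ((m * X y - b) / 2)) ^ 2) Q := by
    simp_rw [hfe]
    exact ((hEl.const_mul _).add (hEm.const_mul _)).sub (hEn.const_mul _)
  have hval : ∫ y, (Real.exp ((l * X y - a) / 2) - Real.exp ((m * X y - b) / 2)) ^ 2 ∂Q =
      2 - 2 * Real.exp (c - (a + b) / 2) := by
    simp_rw [hfe]
    have hadd : Integrable (fun y => Real.exp (-a) * Real.exp (l * X y) +
        Real.exp (-b) * Real.exp (m * X y)) Q := (hEl.const_mul _).add (hEm.const_mul _)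
    rw [integral_sub hadd (hEn.const_mul _),
      integral_add (hEl.const_mul _) (hEm.const_mul _), integral_const_mul, integral_const_mul,
      integral_const_mul]
    change Real.exp (-a) * mgf X Q l + Real.exp (-b) * mgf X Q m -
      2 * Real.exp (-(a + b) / 2) * mgf X Q ((l + m) / 2) = _
    rw [← exp_cgf hEl, ← exp_cgf hEm, ← exp_cgf hEn, ← ha, ← hb, ← hc, mul_assoc,
      ← Real.exp_add, ← Real.exp_add, ← Real.exp_add, neg_add_cancel, neg_add_cancel,
      Real.exp_zero]
    have : -(a + b) / 2 + c = c - (a + b) / 2 := by ring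
    rw [this]; norm_num
  have hnn : (0 : T → ℝ) ≤ fun y => (Real.exp ((l * X y - a) / 2) -
      Real.exp ((m * X y - b) / 2)) ^ 2 := fun y => sq_nonneg _
  constructor
  · have := integral_nonneg (μ := Q) hnn
    rw [hval] at this
    have h1 : Real.exp (c - (a + b) / 2) ≤ 1 := by linarith
    rw [Real.exp_le_one_iff] at h1
    linarith
  · intro h
    have h1 : c - (a + b) / 2 = 0 := by linarith
    rw [h1, Real.exp_zero, mul_one, sub_self, integral_eq_zero_iff_of_nonneg hnn hI] at hval
    refine ⟨(b - a) / (m - l), ?_⟩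
    filter_upwards [hval] with y hy
    have h2 : Real.exp ((l * X y - a) / 2) = Real.exp ((m * X y - b) / 2) := by
      have := pow_eq_zero_iff (two_ne_zero) |>.1 hy
      linarith
    have h3 := Real.exp_injective h2
    rw [eq_div_iff (by linarith)]
    linarith

lemma aux_sup (L : ℝ → ℝ) (F : ℝ → EReal)
    (hF : ∀ D, F D = ⨆ l ∈ Iic (0 : ℝ), ((l * D - L l : ℝ) : EReal)) (D l : ℝ) (hl : l ≤ 0)
    (hmax : ∀ m ≤ 0, m * D - L m ≤ l * D - L l) : F D = ((l * D - L l : ℝ) : EReal) := by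
  rw [hF]
  refine le_antisymm (iSup₂_le fun m hm => EReal.coe_le_coe_iff.2 (hmax m hm)) ?_
  exact le_iSup₂_of_le l hl le_rfl

lemma aux_abs (L : ℝ → ℝ) (F : ℝ → EReal) (A : Set ℝ) (hA : Convex ℝ A)
    (hF : ∀ D, F D = ⨆ l ∈ Iic (0 : ℝ), ((l * D - L l : ℝ) : EReal))
    (hdiff : ∀ l < 0, ∃ d, HasDerivAt L d l)
    (hcont : ContinuousOn L (Iic 0)) (hL0 : L 0 = 0)
    (hfin : ∀ D ∈ A, ∃ D' < D, F D' ≠ ⊤)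
    (hpos : ∀ D ∈ A, ∃ l < 0, 0 < l * D - L l)
    (huniq : ∀ l < 0, ∀ m < 0, l < m → 2 * L ((l + m) / 2) ≤ L l + L m ∧
      (2 * L ((l + m) / 2) = L l + L m → L (2 * l) = 2 * L l)) :
    StrictConvexOn ℝ A (fun t => (F t).toReal) ∧ StrictAntiOn (fun t => (F t).toReal) A ∧
    ∀ D ∈ A, ∃! l : ℝ, l < 0 ∧ F D = ((l * D - L l : ℝ) : EReal) := by
  have hle : ∀ D l, l ≤ 0 → ((l * D - L l : ℝ) : EReal) ≤ F D := fun D l hl => by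
    rw [hF]; exact le_iSup₂_of_le l hl le_rfl
  have hex : ∀ D ∈ A, ∃ l < 0, 0 < l * D - L l ∧ ∀ m ≤ 0, m * D - L m ≤ l * D - L l := by
    intro D hD
    obtain ⟨D', hD', hD'F⟩ := hfin D hD
    obtain ⟨l₀, hl₀, hp⟩ := hpos D hD
    set C := (F D').toReal
    have hC : ∀ m ≤ 0, m * D' - L m ≤ C := fun m hm => by
      have h1 := hle D' m hm
      have h2 := EReal.toReal_le_toReal h1 (EReal.coe_ne_bot _) hD'F
      rwa [EReal.toReal_coe] at h2
    have hC0 : 0 ≤ C := by simpa [hL0] using hC 0 le_rfl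
    set R := min l₀ (-(C / (D - D')))
    have hc : ContinuousOn (fun m => m * D - L m) (Icc R 0) :=
      ((continuous_id.mul continuous_const).continuousOn).sub
        (hcont.mono fun x hx => hx.2)
    have hR : R ≤ l₀ := min_le_left _ _
    obtain ⟨l, hl, hlm⟩ := isCompact_Icc.exists_isMaxOn ⟨l₀, hR, hl₀.le⟩ hc
    have hlm0 : l₀ * D - L l₀ ≤ l * D - L l := hlm (show l₀ ∈ Icc R 0 from ⟨hR, hl₀.le⟩)
    have hlp : 0 < l * D - L l := hp.trans_le hlm0
    refine ⟨l, lt_of_le_of_ne hl.2 ?_, hlp, fun m hm => ?_⟩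
    · rintro rfl
      simp [hL0] at hlp
    · by_cases hmR : R ≤ m
      · exact hlm (show m ∈ Icc R 0 from ⟨hmR, hm⟩)
      · have h1 : m ≤ -(C / (D - D')) := (not_le.1 hmR).le.trans (min_le_right _ _)
        have h2 : 0 < D - D' := by linarith
        have h3 : C / (D - D') ≤ -m := by linarith
        rw [div_le_iff₀ h2] at h3
        have h4 := hC m hm
        nlinarith
  have hreal : ∀ D ∈ A, ((F D).toReal : EReal) = F D := by
    intro D hD
    obtain ⟨l, hl, -, hm⟩ := hex D hD
    rw [aux_sup L F hF D l hl.le hm, EReal.toReal_coe]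
  have hler : ∀ D ∈ A, ∀ l ≤ 0, l * D - L l ≤ (F D).toReal := fun D hD l hl => by
    rw [← EReal.coe_le_coe_iff, hreal D hD]; exact hle D l hl
  have hder : ∀ D ∈ A, ∀ l < 0, ∀ d, HasDerivAt L d l → (F D).toReal = l * D - L l → d = D := by
    intro D hD l hl d hd he
    have hloc : IsLocalMax (fun m => m * D - L m) l := by
      filter_upwards [Iio_mem_nhds hl] with m hm
      rw [← he]; exact hler D hD m (le_of_lt hm)
    have := hloc.hasDerivAt_eq_zero (((hasDerivAt_id l).mul_const D).sub hd)
    linarith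
  refine ⟨⟨hA, ?_⟩, ?_, ?_⟩
  · intro D₁ h₁ D₂ h₂ hne a b ha hb hab
    have hD := hA h₁ h₂ ha.le hb.le hab
    obtain ⟨l, hl, -, hm⟩ := hex _ hD
    have hv : (F (a • D₁ + b • D₂)).toReal = l * (a * D₁ + b * D₂) - L l := by
      rw [aux_sup L F hF _ l hl.le hm, EReal.toReal_coe]; simp
    dsimp only
    rw [hv]
    have e1 := hler D₁ h₁ l hl.le
    have e2 := hler D₂ h₂ l hl.le
    simp only [smul_eq_mul]
    obtain ⟨d, hd⟩ := hdiff l hl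
    have hs : l * (a * D₁ + b * D₂) - L l = a * (l * D₁ - L l) + b * (l * D₂ - L l) := by
      have : b = 1 - a := by linarith
      subst this; ring
    rw [hs]
    rcases e1.lt_or_eq with e1' | e1'
    · exact add_lt_add_of_lt_of_le (mul_lt_mul_of_pos_left e1' ha)
        (mul_le_mul_of_nonneg_left e2 hb.le)
    · rcases e2.lt_or_eq with e2' | e2'
      · exact add_lt_add_of_le_of_lt (mul_le_mul_of_nonneg_left e1 ha.le)
          (mul_lt_mul_of_pos_left e2' hb)
      · exact absurd ((hder D₁ h₁ l hl d hd e1'.symm).symm.trans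
          (hder D₂ h₂ l hl d hd e2'.symm)) hne
  · intro D₁ h₁ D₂ h₂ hlt
    obtain ⟨l, hl, -, hm⟩ := hex _ h₂
    have hv : (F D₂).toReal = l * D₂ - L l := by
      rw [aux_sup L F hF _ l hl.le hm, EReal.toReal_coe]
    have := hler D₁ h₁ l hl.le
    dsimp only
    nlinarith
  · intro D hD
    obtain ⟨l₀, hl₀, hp, hm₀⟩ := hex D hD
    have hv := aux_sup L F hF _ l₀ hl₀.le hm₀
    have key : ∀ l < 0, ∀ m < 0, l < m → l * D - L l = l₀ * D - L l₀ →
        m * D - L m = l₀ * D - L l₀ → False := by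
      intro l hl m hm hlm e1 e2
      obtain ⟨h1, h2⟩ := huniq l hl m hm hlm
      have h3 := hm₀ ((l + m) / 2) (by linarith)
      have h4 := h2 (le_antisymm h1 (by nlinarith))
      have h5 := hm₀ (2 * l) (by linarith)
      rw [h4] at h5
      linarith
    refine ⟨l₀, ⟨hl₀, hv⟩, ?_⟩
    rintro m ⟨hm, hmv⟩
    rw [hv] at hmv
    have hmv' : l₀ * D - L l₀ = m * D - L m := EReal.coe_eq_coe_iff.1 hmv
    rcases lt_trichotomy m l₀ with h | h | h
    · exact (key m hm l₀ hl₀ h hmv'.symm rfl).elim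
    · exact h
    · exact (key l₀ hl₀ m hm h rfl hmv'.symm).elim

lemma aux_negLog {T : Type*} [MeasurableSpace T] (Q : Measure T) [IsProbabilityMeasure Q]
    (X : T → ℝ) (hX : Measurable X) (h0 : ∀ y, 0 ≤ X y) {l : ℝ} (hl : l ≤ 0) :
    negLog (∫⁻ y, ENNReal.ofReal (Real.exp (l * X y)) ∂Q) = ENNReal.ofReal (- cgf X Q l) := by
  have hM := aux_mgf_pos Q X hX h0 hl
  have h : ∫⁻ y, ENNReal.ofReal (Real.exp (l * X y)) ∂Q = ENNReal.ofReal (mgf X Q l) :=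
    (ofReal_integral_eq_lintegral_ofReal (aux_int Q X hX h0 hl)
      (ae_of_all _ fun y => (Real.exp_pos _).le)).symm
  rw [h, negLog, if_neg (by simpa using hM), ENNReal.toReal_ofReal hM.le]
  rfl

section Two
variable {S T : Type*} [MeasurableSpace S] [MeasurableSpace T]
    (ρ : S × T → ℝ) (P : Measure S) (Q : Measure T)

/-- The real-valued version of `Lam`. -/
def LamR (l : ℝ) : ℝ := ∫ x, cgf (fun y => ρ (x, y)) Q l ∂P

lemma aux_Lam (hρm : Measurable ρ) (hρ0 : ∀ z, 0 ≤ ρ z) [IsProbabilityMeasure Q]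
    {l : ℝ} (hl : l ≤ 0) :
    Lam ρ P Q l = -((∫⁻ x, ENNReal.ofReal (- cgf (fun y => ρ (x, y)) Q l) ∂P : ℝ≥0∞) : EReal) := by
  rcases hl.lt_or_eq with h | rfl
  · rw [Lam, if_neg (not_le.2 h)]
    congr 3
    ext x
    exact aux_negLog Q _ (by fun_prop) (fun y => hρ0 _) hl
  · simp [Lam, posLog]

lemma aux_meas_mgf (hρm : Measurable ρ) [IsProbabilityMeasure Q] (l : ℝ) :
    Measurable fun x => mgf (fun y => ρ (x, y)) Q l := by
  have : StronglyMeasurable (fun z : S × T => Real.exp (l * ρ z)) :=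
    Measurable.stronglyMeasurable (by fun_prop)
  exact this.integral_prod_right.measurable

lemma aux_meas (hρm : Measurable ρ) [IsProbabilityMeasure Q] (l : ℝ) :
    Measurable fun x => cgf (fun y => ρ (x, y)) Q l :=
  Real.measurable_log.comp (aux_meas_mgf ρ Q hρm l)

lemma aux_integrable (hρm : Measurable ρ) (hρ0 : ∀ z, 0 ≤ ρ z) [IsProbabilityMeasure Q]
    (hne : {D : ℝ | LamStar ρ P Q D ≠ ⊤}.Nonempty) {l : ℝ} (hl : l ≤ 0) :
    Integrable (fun x => cgf (fun y => ρ (x, y)) Q l) P := by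
  obtain ⟨D, hD⟩ := hne
  have h1 : ∫⁻ x, ENNReal.ofReal (- cgf (fun y => ρ (x, y)) Q l) ∂P ≠ ∞ := by
    intro h
    apply hD
    rw [eq_top_iff, LamStar]
    refine le_iSup₂_of_le l hl ?_
    rw [aux_Lam ρ P Q hρm hρ0 hl, h, EReal.coe_ennreal_top, EReal.neg_top, EReal.coe_sub_bot]
  rw [← integrable_neg_iff]
  refine ⟨(aux_meas ρ Q hρm l).neg.aestronglyMeasurable, ?_⟩
  rw [hasFiniteIntegral_iff_ofReal]
  · exact h1.lt_top
  · exact ae_of_all _ fun x => neg_nonneg.2 (aux_cgf_nonpos Q _ (by fun_prop) (fun y => hρ0 _) hl)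

lemma aux_LamR (hρm : Measurable ρ) (hρ0 : ∀ z, 0 ≤ ρ z) [IsProbabilityMeasure Q]
    (hne : {D : ℝ | LamStar ρ P Q D ≠ ⊤}.Nonempty) {l : ℝ} (hl : l ≤ 0) :
    Lam ρ P Q l = (LamR ρ P Q l : EReal) := by
  have hI := (aux_integrable ρ P Q hρm hρ0 hne hl).neg
  have hnn : ∀ x, 0 ≤ - cgf (fun y => ρ (x, y)) Q l := fun x =>
    neg_nonneg.2 (aux_cgf_nonpos Q _ (by fun_prop) (fun y => hρ0 _) hl)
  rw [aux_Lam ρ P Q hρm hρ0 hl]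
  have h := ofReal_integral_eq_lintegral_ofReal hI (ae_of_all _ hnn)
  simp only [Pi.neg_apply] at h
  rw [← h, EReal.coe_ennreal_ofReal, max_eq_left (integral_nonneg hnn), integral_neg]
  simp [LamR]

lemma aux_pos (hρm : Measurable ρ) (hρ0 : ∀ z, 0 ≤ ρ z) [IsProbabilityMeasure Q]
    [IsProbabilityMeasure P]
    (hne : {D : ℝ | LamStar ρ P Q D ≠ ⊤}.Nonempty) (D : ℝ)
    (hD : ENNReal.ofReal D < DavePQ ρ P Q) : ∃ l < 0, 0 < l * D - LamR ρ P Q l := by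
  by_contra! hcon
  refine absurd hD (not_lt.2 ?_)
  let f : ℕ → S × T → ℝ≥0∞ := fun n z =>
    ENNReal.ofReal (((n : ℝ) + 1) * (1 - Real.exp (-((n : ℝ) + 1)⁻¹ * ρ z)))
  have hfm : ∀ n, Measurable (f n) := fun n => by fun_prop
  have hlim : ∀ z, Tendsto (fun n => f n z) atTop (𝓝 (ENNReal.ofReal (ρ z))) := by
    intro z
    apply (ENNReal.continuous_ofReal.tendsto _).comp
    have hd : HasDerivAt (fun t : ℝ => -Real.exp (-t * ρ z)) (ρ z) 0 := by
      have := (((hasDerivAt_id (0 : ℝ)).neg.mul_const (ρ z)).exp).neg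
      refine this.congr_deriv ?_
      simp
    have ht := hd.tendsto_slope_zero_right
    have hn : Tendsto (fun n : ℕ => ((n : ℝ) + 1)⁻¹) atTop (𝓝[>] 0) :=
      tendsto_inv_atTop_nhdsGT_zero.comp
        (tendsto_atTop_add_const_right _ _ tendsto_natCast_atTop_atTop)
    refine (ht.comp hn).congr fun n => ?_
    simp
    left; ring
  have hbd : ∀ n, ∫⁻ z, f n z ∂(P.prod Q) ≤ ENNReal.ofReal D := by
    intro n
    have hn : (0 : ℝ) < (n : ℝ) + 1 := by positivity
    set l : ℝ := -((n : ℝ) + 1)⁻¹ with hl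
    have hl0 : l < 0 := by rw [hl]; simpa using hn
    have hnl : ((n : ℝ) + 1) * l = -1 := by rw [hl]; field_simp
    rw [lintegral_prod _ (hfm n).aemeasurable]
    have hx : ∀ x, ∫⁻ y, f n (x, y) ∂Q ≤
        ENNReal.ofReal (((n : ℝ) + 1) * (- cgf (fun y => ρ (x, y)) Q l)) := by
      intro x
      have hXm : Measurable fun y => ρ (x, y) := by fun_prop
      have hE := aux_int Q _ hXm (fun y => hρ0 _) hl0.le
      have hi : Integrable (fun y => ((n : ℝ) + 1) * (1 - Real.exp (l * ρ (x, y)))) Q :=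
        ((integrable_const _).sub hE).const_mul _
      rw [← ofReal_integral_eq_lintegral_ofReal hi]
      · apply ENNReal.ofReal_le_ofReal
        rw [integral_const_mul, integral_sub (integrable_const _) hE]
        apply mul_le_mul_of_nonneg_left _ hn.le
        simp only [integral_const, probReal_univ, one_smul]
        have := Real.log_le_sub_one_of_pos (aux_mgf_pos Q _ hXm (fun y => hρ0 _) hl0.le)
        change 1 - mgf (fun y => ρ (x, y)) Q l ≤ - Real.log (mgf (fun y => ρ (x, y)) Q l)
        linarith
      · refine ae_of_all _ fun y => mul_nonneg hn.le ?_
        rw [sub_nonneg, Real.exp_le_one_iff]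
        exact mul_nonpos_of_nonpos_of_nonneg hl0.le (hρ0 _)
    refine (lintegral_mono hx).trans ?_
    have hI := (aux_integrable ρ P Q hρm hρ0 hne hl0.le).neg.const_mul ((n : ℝ) + 1)
    have h := ofReal_integral_eq_lintegral_ofReal hI (ae_of_all _ fun x =>
      mul_nonneg hn.le (neg_nonneg.2 (aux_cgf_nonpos Q _ (by fun_prop) (fun y => hρ0 _) hl0.le)))
    simp only [Pi.neg_apply] at h
    rw [← h, integral_const_mul, integral_neg]
    apply ENNReal.ofReal_le_ofReal
    have h1 := hcon l hl0
    change ((n : ℝ) + 1) * (-LamR ρ P Q l) ≤ D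
    have h2 := mul_le_mul_of_nonneg_left h1 hn.le
    have h3 : ((n : ℝ) + 1) * (l * D) = -D := by rw [← mul_assoc, hnl]; ring
    rw [mul_sub, h3] at h2
    linarith
  calc DavePQ ρ P Q = ∫⁻ z, liminf (fun n => f n z) atTop ∂(P.prod Q) := by
        rw [DavePQ]; congr 1; ext z; exact (hlim z).liminf_eq.symm
    _ ≤ liminf (fun n => ∫⁻ z, f n z ∂(P.prod Q)) atTop := lintegral_liminf_le hfm
    _ ≤ liminf (fun _ : ℕ => ENNReal.ofReal D) atTop :=
        liminf_le_liminf (Eventually.of_forall hbd)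
    _ = ENNReal.ofReal D := by simp

lemma aux_LamR_cont (hρm : Measurable ρ) (hρ0 : ∀ z, 0 ≤ ρ z) [IsProbabilityMeasure Q]
    (hne : {D : ℝ | LamStar ρ P Q D ≠ ⊤}.Nonempty) :
    ContinuousOn (LamR ρ P Q) (Iic 0) := by
  intro l hl
  have hl' : l ≤ 0 := hl
  refine continuousWithinAt_of_dominated
    (bound := fun x => - cgf (fun y => ρ (x, y)) Q (l - 1))
    (Eventually.of_forall fun m => (aux_meas ρ Q hρm m).aestronglyMeasurable) ?_
    (aux_integrable ρ P Q hρm hρ0 hne (by linarith)).neg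
    (ae_of_all _ fun x => aux_cgf_cont Q _ (by fun_prop) (fun y => hρ0 _) l hl)
  filter_upwards [self_mem_nhdsWithin, mem_nhdsWithin_of_mem_nhds (Ioi_mem_nhds (sub_one_lt l))]
    with m hm hm1
  refine ae_of_all _ fun x => ?_
  have hXm : Measurable fun y => ρ (x, y) := by fun_prop
  rw [Real.norm_eq_abs, abs_of_nonpos (aux_cgf_nonpos Q _ hXm (fun y => hρ0 _) hm)]
  exact neg_le_neg (aux_cgf_mono Q _ hXm (fun y => hρ0 _) (le_of_lt hm1) hm)

lemma aux_LamR_diff (hρm : Measurable ρ) (hρ0 : ∀ z, 0 ≤ ρ z) [IsProbabilityMeasure Q]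
    (hne : {D : ℝ | LamStar ρ P Q D ≠ ⊤}.Nonempty) {l : ℝ} (hl : l < 0) :
    ∃ d, HasDerivAt (LamR ρ P Q) d l := by
  have hs : Ioo (l - 1) (l / 2) ∈ 𝓝 l := Ioo_mem_nhds (by linarith) (by linarith)
  refine ⟨_, (hasDerivAt_integral_of_dominated_loc_of_deriv_le hs
    (F := fun m x => cgf (fun y => ρ (x, y)) Q m)
    (F' := fun m x => (∫ y, ρ (x, y) * Real.exp (m * ρ (x, y)) ∂Q) / mgf (fun y => ρ (x, y)) Q m)
    (bound := fun x => (-(l / 2))⁻¹ * (- cgf (fun y => ρ (x, y)) Q (l - 1)))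
    (Eventually.of_forall fun m => (aux_meas ρ Q hρm m).aestronglyMeasurable)
    (aux_integrable ρ P Q hρm hρ0 hne hl.le) ?_ ?_
    ((aux_integrable ρ P Q hρm hρ0 hne (by linarith)).neg.const_mul _) ?_).2⟩
  · have : StronglyMeasurable (fun z : S × T => ρ z * Real.exp (l * ρ z)) :=
      Measurable.stronglyMeasurable (by fun_prop)
    exact (this.integral_prod_right.measurable.div (aux_meas_mgf ρ Q hρm l)).aestronglyMeasurable
  · refine ae_of_all _ fun x m hm => ?_
    have hXm : Measurable fun y => ρ (x, y) := by fun_prop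
    have hm0 : m < 0 := by linarith [hm.2]
    have h1 := aux_deriv_bound Q _ hXm (fun y => hρ0 _) hm0
    have h2 := aux_cgf_mono Q _ hXm (fun y => hρ0 _) hm.1.le hm0.le
    have h3 : 0 ≤ (∫ y, ρ (x, y) * Real.exp (m * ρ (x, y)) ∂Q) / mgf (fun y => ρ (x, y)) Q m :=
      div_nonneg (integral_nonneg fun y => mul_nonneg (hρ0 _) (Real.exp_pos _).le) mgf_nonneg
    have h4 := mul_le_mul_of_nonneg_right (show -(l / 2) ≤ -m by linarith [hm.2]) h3
    rw [Real.norm_eq_abs, abs_of_nonneg h3, inv_mul_eq_div, le_div_iff₀ (by linarith), mul_comm]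
    linarith
  · exact ae_of_all _ fun x m hm =>
      aux_cgf_deriv Q _ (by fun_prop) (fun y => hρ0 _) (by linarith [hm.2])

lemma aux_LamR_mid (hρm : Measurable ρ) (hρ0 : ∀ z, 0 ≤ ρ z) [IsProbabilityMeasure Q]
    (hne : {D : ℝ | LamStar ρ P Q D ≠ ⊤}.Nonempty) {l m : ℝ} (hm : m < 0) (hlm : l < m) :
    2 * LamR ρ P Q ((l + m) / 2) ≤ LamR ρ P Q l + LamR ρ P Q m ∧
      (2 * LamR ρ P Q ((l + m) / 2) = LamR ρ P Q l + LamR ρ P Q m →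
        LamR ρ P Q (2 * l) = 2 * LamR ρ P Q l) := by
  have i1 := aux_integrable ρ P Q hρm hρ0 hne (hlm.trans hm).le
  have i2 := aux_integrable ρ P Q hρm hρ0 hne hm.le
  have i3 := aux_integrable ρ P Q hρm hρ0 hne (show (l + m) / 2 ≤ 0 by linarith)
  have hmid := fun x => aux_mid Q (fun y => ρ (x, y)) (by fun_prop) (fun y => hρ0 _) hlm hm.le
  let g : S → ℝ := fun x => cgf (fun y => ρ (x, y)) Q l + cgf (fun y => ρ (x, y)) Q m
    - 2 * cgf (fun y => ρ (x, y)) Q ((l + m) / 2)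
  have i12 : Integrable (fun x => cgf (fun y => ρ (x, y)) Q l + cgf (fun y => ρ (x, y)) Q m) P :=
    i1.add i2
  have hg : Integrable g P := i12.sub (i3.const_mul 2)
  have hgv : ∫ x, g x ∂P = LamR ρ P Q l + LamR ρ P Q m - 2 * LamR ρ P Q ((l + m) / 2) := by
    simp only [g]
    rw [integral_sub i12 (i3.const_mul 2), integral_add i1 i2, integral_const_mul]
    rfl
  have hg0 : 0 ≤ g := fun x => sub_nonneg.2 (hmid x).1
  constructor
  · have := integral_nonneg (μ := P) hg0
    linarith
  · intro h
    have h0 : ∫ x, g x ∂P = 0 := by rw [hgv, h, sub_self]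
    rw [integral_eq_zero_iff_of_nonneg hg0 hg] at h0
    unfold LamR
    rw [← integral_const_mul]
    apply integral_congr_ae
    filter_upwards [h0] with x hx
    obtain ⟨c, hc⟩ := (hmid x).2 (by simp only [g, Pi.zero_apply] at hx; linarith)
    have e : ∀ t, cgf (fun y => ρ (x, y)) Q t = t * c := fun t => by
      rw [cgf, mgf_congr hc]; exact cgf_const c
    rw [e, e]; ring

end Two

end Helpers

/-- if `D_min` is finite and `D_min < D_ave`, then `Λ*(P,Q,·)` is
strictly convex and strictly decreasing on `(D_min, D_ave)`, and for each
`D ∈ (D_min, D_ave)` there is a unique `λ_D < 0` with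
`Λ*(P,Q,D) = λ_D D - Λ(P,Q,λ_D)`. -/
theorem stmt7 {S T : Type*} [MeasurableSpace S] [StandardBorelSpace S]
    [MeasurableSpace T] [StandardBorelSpace T]
    (ρ : S × T → ℝ) (hρm : Measurable ρ) (hρ0 : ∀ z, 0 ≤ ρ z)
    (P : Measure S) (Q : Measure T) [IsProbabilityMeasure P] [IsProbabilityMeasure Q]
    (hne : {D : ℝ | LamStar ρ P Q D ≠ ⊤}.Nonempty)
    (hlt : ENNReal.ofReal (DminPQ ρ P Q) < DavePQ ρ P Q) :
    StrictConvexOn ℝ {D : ℝ | DminPQ ρ P Q < D ∧ ENNReal.ofReal D < DavePQ ρ P Q}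
      (fun t => (LamStar ρ P Q t).toReal) ∧
    StrictAntiOn (fun t => (LamStar ρ P Q t).toReal)
      {D : ℝ | DminPQ ρ P Q < D ∧ ENNReal.ofReal D < DavePQ ρ P Q} ∧
    (∀ D : ℝ, DminPQ ρ P Q < D → ENNReal.ofReal D < DavePQ ρ P Q →
      ∃! l : ℝ, l < 0 ∧ LamStar ρ P Q D = ((l * D : ℝ) : EReal) - Lam ρ P Q l) := by
  have hcoe : ∀ D l : ℝ, l ≤ 0 → ((l * D : ℝ) : EReal) - Lam ρ P Q l =
      ((l * D - LamR ρ P Q l : ℝ) : EReal) := fun D l hl => by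
    rw [aux_LamR ρ P Q hρm hρ0 hne hl, EReal.coe_sub]
  have hstar : ∀ D, LamStar ρ P Q D =
      ⨆ l ∈ Iic (0 : ℝ), ((l * D - LamR ρ P Q l : ℝ) : EReal) := fun D =>
    iSup_congr fun l => iSup_congr fun hl => hcoe D l hl
  have hfin : ∀ D, DminPQ ρ P Q < D → ∃ D' < D, LamStar ρ P Q D' ≠ ⊤ := by
    intro D hD
    obtain ⟨D', h1, h2⟩ := exists_lt_of_csInf_lt hne hD
    exact ⟨D', h2, h1⟩
  have hA : Convex ℝ {D : ℝ | DminPQ ρ P Q < D ∧ ENNReal.ofReal D < DavePQ ρ P Q} := by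
    apply OrdConnected.convex
    refine ⟨fun a ha b hb c hc => ⟨ha.1.trans_le hc.1, ?_⟩⟩
    exact (ENNReal.ofReal_le_ofReal hc.2).trans_lt hb.2
  obtain ⟨h1, h2, h3⟩ := aux_abs (LamR ρ P Q) (LamStar ρ P Q) _ hA hstar
    (fun l hl => aux_LamR_diff ρ P Q hρm hρ0 hne hl) (aux_LamR_cont ρ P Q hρm hρ0 hne)
    (by simp [LamR]) (fun D hD => hfin D hD.1)
    (fun D hD => aux_pos ρ P Q hρm hρ0 hne D hD.2)
    (fun l _ m hm hlm => aux_LamR_mid ρ P Q hρm hρ0 hne hm hlm)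
  refine ⟨h1, h2, fun D hD hD' => ?_⟩
  obtain ⟨l, ⟨hl, hlv⟩, hu⟩ := h3 D ⟨hD, hD'⟩
  refine ⟨l, ⟨hl, by rw [hcoe D l hl.le]; exact hlv⟩, ?_⟩
  rintro m ⟨hm, hmv⟩
  exact hu m ⟨hm, by rw [← hcoe D m hm.le]; exact hmv⟩

end
end
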